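/- Let k ∈ (1,3) and h ≥ 0, and consider the toy model with g(u) = ku on [0,1), g(u) = 4 − u for u ≥ 1. If the equation λ₁(c,h)/μ₁(c,h) = (3−k)/4 has a solution c_* ≥ c_#(h), then c_* is the minimal speed of propagation: the equation u_t = u_xx − u + g(u(t−h,x)) has a wavefront of speed c if and only if c ≥ c_*. If the equation λ₁(c,h)/μ₁(c,h) = (3−k)/4 has no positive root c, then c_#(h) is the minimal speed of propagation: a wavefront of speed c exists if and only if c ≥ c_#(h). -/

import Mathlib

open Filter Set

noncomputable section

/-- The piecewise linear birth function of the toy model. -/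
def gtoy (k u : ℝ) : ℝ := if u < 1 then k * u else 4 - u

/-- The characteristic function `χ(z,c) = z² - cz - 1 + k e^{-zch}` at the zero
equilibrium of the toy model. -/
def chi (k c h z : ℝ) : ℝ := z ^ 2 - c * z - 1 + k * Real.exp (-(z * c * h))

/-- The characteristic function `χ_κ(z) = z² - cz - 1 - e^{-zch}` at the positive
equilibrium `κ = 2` of the toy model. -/
def chiK (c h z : ℝ) : ℝ := z ^ 2 - c * z - 1 - Real.exp (-(z * c * h))

/-- A wavefront profile of speed `c` for the toy model: positive, `C¹`,
twice differentiable and satisfying the profile equation at every point where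
`φ(t - ch) ≠ 1`, with `φ(-∞) = 0` and `φ(+∞) = 2`. -/
def ToyWavefront (k c h : ℝ) (φ : ℝ → ℝ) : Prop :=
  ContDiff ℝ 1 φ ∧ (∀ t, 0 < φ t) ∧
    Tendsto φ atBot (nhds 0) ∧ Tendsto φ atTop (nhds 2) ∧
    ∀ t : ℝ, φ (t - c * h) ≠ 1 →
      HasDerivAt (deriv φ) (c * deriv φ t + φ t - gtoy k (φ (t - c * h))) t


lemma chi_tangent {k c h : ℝ} (hk : 0 ≤ k) (y w : ℝ) :
    chi k c h y + (2 * y - c - k * c * h * Real.exp (-(y * c * h))) * (w - y) + (w - y) ^ 2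
      ≤ chi k c h w := by
  have h1 : Real.exp (-(y * c * h)) * (1 - (w - y) * c * h) ≤ Real.exp (-(w * c * h)) := by
    have e : Real.exp (-(w * c * h)) = Real.exp (-(y * c * h)) * Real.exp (-((w - y) * c * h)) := by
      rw [← Real.exp_add]; congr 1; ring
    rw [e]
    apply mul_le_mul_of_nonneg_left _ (Real.exp_pos _).le
    have := Real.add_one_le_exp (-((w - y) * c * h))
    linarith
  have h2 := mul_le_mul_of_nonneg_left h1 hk
  unfold chi
  nlinarith [h2]

lemma chi_cont (k c h : ℝ) : Continuous (chi k c h) := by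
  unfold chi; fun_prop

lemma chiK_cont (c h : ℝ) : Continuous (chiK c h) := by
  unfold chiK; fun_prop

lemma chi_pos_large {k c h z : ℝ} (hk : 1 < k) (hz : c + 1 ≤ z) (hz1 : 1 ≤ z) : 0 < chi k c h z := by
  unfold chi
  have := mul_pos (by linarith : (0:ℝ) < k) (Real.exp_pos (-(z * c * h)))
  nlinarith

/-- positive beyond the largest root -/
lemma chi_pos_of_gt {k c h l : ℝ} (hk : 1 < k)
    (hl : ∀ z : ℝ, chi k c h z = 0 → z ≤ l) {z : ℝ} (hz : l < z) : 0 < chi k c h z := by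
  by_contra hn
  push Not at hn
  set b := max z (max (c + 1) 1) with hb
  have hbp : 0 < chi k c h b :=
    chi_pos_large hk ((le_max_left _ _).trans (le_max_right _ _)) ((le_max_right _ _).trans (le_max_right _ _))
  have hzb : z ≤ b := le_max_left _ _
  have := intermediate_value_Icc hzb (chi_cont k c h).continuousOn
  obtain ⟨x, hx, hx0⟩ := this ⟨hn, hbp.le⟩
  have := hl x hx0
  linarith [hx.1]

lemma chi_pos_of_nonpos {k c h z : ℝ} (hk : 1 < k) (hc : 0 ≤ c) (hh : 0 ≤ h) (hz : z ≤ 0) :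
    0 < chi k c h z := by
  unfold chi
  have h1 : 1 ≤ Real.exp (-(z * c * h)) := by
    apply Real.one_le_exp
    have : 0 ≤ (-z) * c * h := by
      have : 0 ≤ -z := by linarith
      positivity
    linarith
  have h2 : 0 ≤ -z * c := mul_nonneg (by linarith) hc
  nlinarith [sq_nonneg z]

/-- change of speed -/
lemma chi_rescale {k c c' h s : ℝ} (hc : 0 < c) (hc' : 0 < c') :
    chi k c h (s / c) - chi k c' h (s / c') = s ^ 2 * (1 / c ^ 2 - 1 / c' ^ 2) := by
  unfold chi
  have e1 : s / c * c = s := by field_simp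
  have e2 : s / c' * c' = s := by field_simp
  rw [mul_comm c (s / c), mul_comm c' (s / c'), e1, e2]
  field_simp
  ring

lemma inv_sq_lt {c c' : ℝ} (hc : 0 < c) (hcc : c < c') : 1 / c' ^ 2 < 1 / c ^ 2 := by
  apply one_div_lt_one_div_of_lt (by positivity)
  nlinarith

lemma chi_sharp_nonneg {k cs h zs : ℝ} (hk : 1 < k) (h0 : chi k cs h zs = 0)
    (h1 : 2 * zs - cs - k * cs * h * Real.exp (-(zs * cs * h)) = 0) (z : ℝ) :
    0 ≤ chi k cs h z := by
  have := chi_tangent (c := cs) (h := h) (by linarith : (0:ℝ) ≤ k) zs z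
  rw [h0, h1] at this
  nlinarith [sq_nonneg (z - zs)]

lemma chi_pos_of_lt_sharp {k c cs h zs : ℝ} (hk : 1 < k) (hh : 0 ≤ h) (hc : 0 < c) (hcs : c < cs)
    (h0 : chi k cs h zs = 0)
    (h1 : 2 * zs - cs - k * cs * h * Real.exp (-(zs * cs * h)) = 0) (z : ℝ) :
    0 < chi k c h z := by
  rcases le_or_gt z 0 with hz | hz
  · exact chi_pos_of_nonpos hk hc.le hh hz
  have h2 := chi_rescale (k := k) (h := h) (s := z * c) hc (hc.trans hcs)
  have h3 := chi_sharp_nonneg hk h0 h1 (z * c / cs)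
  have h4 := inv_sq_lt hc hcs
  have e : z * c / c = z := by field_simp
  rw [e] at h2
  have : 0 < (z * c) ^ 2 * (1 / c ^ 2 - 1 / cs ^ 2) := by
    apply mul_pos (by positivity); linarith
  linarith

lemma chi_sharp_point {k c cs h zs : ℝ} (hcs : 0 < cs) (hc : cs ≤ c)
    (h0 : chi k cs h zs = 0) : chi k c h (zs * cs / c) ≤ 0 := by
  have h2 := chi_rescale (k := k) (h := h) (s := zs * cs) (hcs.trans_le hc) hcs
  have e : zs * cs / cs = zs := by field_simp
  rw [e, h0] at h2
  have h4 : 1 / c ^ 2 ≤ 1 / cs ^ 2 := by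
    apply one_div_le_one_div_of_le (by positivity); nlinarith
  have : 0 ≤ (zs * cs) ^ 2 * (1 / cs ^ 2 - 1 / c ^ 2) := mul_nonneg (sq_nonneg _) (by linarith)
  nlinarith

lemma chi_sharp_point_lt {k c cs h zs : ℝ} (hcs : 0 < cs) (hc : cs < c) (hz : 0 < zs)
    (h0 : chi k cs h zs = 0) : chi k c h (zs * cs / c) < 0 := by
  have h2 := chi_rescale (k := k) (h := h) (s := zs * cs) (hcs.trans hc) hcs
  have e : zs * cs / cs = zs := by field_simp
  rw [e, h0] at h2
  have h4 := inv_sq_lt hcs hc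
  have : 0 < (zs * cs) ^ 2 * (1 / cs ^ 2 - 1 / c ^ 2) := mul_pos (by positivity) (by linarith)
  nlinarith

/-- second root -/
lemma exists_lam2 {k c cs h zs l : ℝ} (hk : 1 < k) (hcs : 0 < cs) (hc : cs ≤ c) (hz : 0 < zs)
    (h0 : chi k cs h zs = 0)
    (h1 : 2 * zs - cs - k * cs * h * Real.exp (-(zs * cs * h)) = 0)
    (hl0 : chi k c h l = 0) (hl : ∀ z : ℝ, chi k c h z = 0 → z ≤ l) :
    ∃ l2, 0 < l2 ∧ ((l2 < l ∧ chi k c h l2 = 0) ∨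
      (l2 = l ∧ 2 * l - c - k * c * h * Real.exp (-(l * c * h)) = 0)) := by
  rcases hc.eq_or_lt with rfl | hlt
  · have hzl := hl zs h0
    have := chi_tangent (c := cs) (h := h) (by linarith : (0:ℝ) ≤ k) zs l
    rw [h0, h1, hl0] at this
    have e : l = zs := by nlinarith [sq_nonneg (l - zs)]
    subst e
    exact ⟨l, hz, Or.inr ⟨rfl, h1⟩⟩
  · have hcp := hcs.trans hlt
    have hn := chi_sharp_point_lt (k := k) (h := h) hcs hlt hz h0
    set w := zs * cs / c with hw
    have hwp : 0 < w := by positivity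
    have hwl : w < l := by
      by_contra hcon
      push Not at hcon
      rcases hcon.eq_or_lt with e | e
      · rw [← e, hl0] at hn; exact lt_irrefl _ hn
      · have := chi_pos_of_gt hk hl e; linarith
    have h00 : 0 < chi k c h 0 := by simp [chi]; linarith
    obtain ⟨x, hx, hx0⟩ := intermediate_value_Icc' hwp.le (chi_cont k c h).continuousOn ⟨hn.le, h00.le⟩
    refine ⟨x, ?_, Or.inl ⟨lt_of_le_of_lt hx.2 hwl, hx0⟩⟩
    rcases hx.1.eq_or_lt with e | e
    · rw [← e] at hx0; linarith
    · exact e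

lemma chiK_pos_large {c h z : ℝ} (hc : 0 < c) (hh : 0 ≤ h) (hz : c + 2 ≤ z) : 0 < chiK c h z := by
  unfold chiK
  have : Real.exp (-(z * c * h)) ≤ 1 := by
    apply Real.exp_le_one_iff.2
    have : 0 ≤ z * c * h := by
      have : 0 ≤ z := by linarith
      positivity
    linarith
  nlinarith

lemma mu_gt {c h m z : ℝ} (hc : 0 < c) (hh : 0 ≤ h) 
    (hm : ∀ z : ℝ, 0 < z → chiK c h z = 0 → z = m) (hz : 0 < z) (hn : chiK c h z < 0) : z < m := by
  by_contra hcon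
  push Not at hcon
  have hb : 0 < chiK c h (max z (c + 2)) := chiK_pos_large hc hh (le_max_right _ _)
  obtain ⟨x, hx, hx0⟩ := intermediate_value_Icc (le_max_left z (c+2)) (chiK_cont c h).continuousOn ⟨hn.le, hb.le⟩
  have := hm x (hz.trans_le hx.1) hx0
  have : x = z := le_antisymm (by linarith) hx.1
  rw [this] at hx0
  linarith

lemma mu_ge {c h m z : ℝ} (hc : 0 < c) (hh : 0 ≤ h) 
    (hm : ∀ z : ℝ, 0 < z → chiK c h z = 0 → z = m) (hz : 0 < z) (hn : chiK c h z ≤ 0) : z ≤ m := by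
  rcases hn.eq_or_lt with e | e
  · exact (hm z hz e).le
  · exact (mu_gt hc hh hm hz e).le

lemma mu_gt_c {c h m : ℝ} (hm : 0 < m) (h0 : chiK c h m = 0) : 0 < m - c := by
  unfold chiK at h0
  have := Real.exp_pos (-(m * c * h))
  by_contra hn
  nlinarith

lemma chiK_lam {k c h l : ℝ} (hk : 1 < k) (h0 : chi k c h l = 0) : chiK c h l < 0 := by
  unfold chi at h0; unfold chiK
  have := Real.exp_pos (-(l * c * h))
  nlinarith

/-- `c μ(c)` is increasing. -/
lemma M_mono {c c' h m m' : ℝ} (hc : 0 < c) (hcc : c ≤ c') (hh : 0 ≤ h) (hm : 0 < m)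
    (h0 : chiK c h m = 0) (hm' : ∀ z : ℝ, 0 < z → chiK c' h z = 0 → z = m') : c * m ≤ c' * m' := by
  have hc' := hc.trans_le hcc
  have : c * m / c' ≤ m' := by
    apply mu_ge hc' hh hm' (by positivity)
    unfold chiK at *
    have e : c * m / c' * c' = m * c := by field_simp
    rw [mul_comm c' (c * m / c'), e]
    have : (c * m / c') ^ 2 ≤ m ^ 2 := by
      apply pow_le_pow_left₀ (by positivity)
      rw [div_le_iff₀ hc']; nlinarith
    linarith
  rw [div_le_iff₀ hc'] at this
  linarith

def HH (k h q m : ℝ) : ℝ :=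
  q * (1 - q) * m + 1 - q ^ 2 - k * Real.exp (-(q * m * h)) - q ^ 2 * Real.exp (-(m * h))

lemma HH_mono {k h q : ℝ} (hk : 1 < k) (hh : 0 ≤ h) (hq : 0 < q) (hq1 : q < 1) {m m' : ℝ} (hm : m < m') :
    HH k h q m < HH k h q m' := by
  unfold HH
  have h1 : Real.exp (-(q * m' * h)) ≤ Real.exp (-(q * m * h)) := by
    apply Real.exp_le_exp.2
    have : q * m * h ≤ q * m' * h := by gcongr
    linarith
  have h2 : Real.exp (-(m' * h)) ≤ Real.exp (-(m * h)) := by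
    apply Real.exp_le_exp.2
    have : m * h ≤ m' * h := by gcongr
    linarith
  have h3 : q * (1 - q) * m < q * (1 - q) * m' := by
    apply mul_lt_mul_of_pos_left hm; apply mul_pos hq; linarith
  have h4 := mul_le_mul_of_nonneg_left h1 (by linarith : (0:ℝ) ≤ k)
  have h5 := mul_le_mul_of_nonneg_left h2 (sq_nonneg q)
  linarith

lemma chi_eq_HH {k c h m : ℝ} (q : ℝ) (h0 : chiK c h m = 0) :
    chi k c h (q * m) = - HH k h q (c * m) := by
  unfold chiK at h0; unfold chi HH
  rw [show q * m * c * h = q * (c * m) * h by ring, show c * m * h = m * c * h by ring]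
  linear_combination q ^ 2 * h0

lemma ratio_lt {k h q cs zs c cst l m lst mst ms : ℝ} (hk : 1 < k) (hh : 0 ≤ h) (hq : 0 < q) (hq1 : q < 1)
    (hcs : 0 < cs) (hz : 0 < zs) (h0 : chi k cs h zs = 0)
    (hc : cs ≤ c) (hcst : c < cst)
    (hl0 : chi k c h l = 0)
    (hm : 0 < m) (hm0 : chiK c h m = 0) (hmu : ∀ z : ℝ, 0 < z → chiK c h z = 0 → z = m)
    (hlst : ∀ z : ℝ, chi k cst h z = 0 → z ≤ lst)
    (hmst0 : chiK cst h mst = 0) (hmst : 0 < mst)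
    (hmst' : ∀ z : ℝ, 0 < z → chiK cst h z = 0 → z = mst)
    (hms : 0 < ms) (hms0 : chiK cs h ms = 0) (hmsu : ∀ z : ℝ, 0 < z → chiK cs h z = 0 → z = ms)
    (heq : lst = q * mst) (hlst0 : chi k cst h lst = 0) : l < q * m := by
  have hcp : 0 < c := hcs.trans_le hc
  have hcstp : 0 < cst := hcp.trans hcst
  have hM : c * m < cst * mst := by
    rcases (M_mono hcp hcst.le hh hm hm0 hmst').eq_or_lt with e | e
    · exfalso
      unfold chiK at hm0 hmst0
      have h1 : m * c * h = mst * cst * h := by rw [mul_comm m, e]; ring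
      rw [h1] at hm0
      have : m ^ 2 = mst ^ 2 := by linear_combination hm0 - hmst0 + e
      have : m = mst := by
        rcases sq_eq_sq_iff_eq_or_eq_neg.1 this with h | h
        · exact h
        · linarith
      rw [this] at e
      have := mul_right_cancel₀ hmst.ne' e
      linarith
    · exact e
  have hHst : HH k h q (cst * mst) = 0 := by
    have := chi_eq_HH (k := k) q hmst0
    rw [← heq, hlst0] at this; linarith
  have hH : HH k h q (c * m) < 0 := by
    rw [← hHst]; exact HH_mono hk hh hq hq1 hM
  have hchi : 0 < chi k c h (q * m) := by rw [chi_eq_HH q hm0]; linarith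
  by_contra hcon
  push Not at hcon
  have hcon' : q * m < l := by
    rcases hcon.eq_or_lt with e | e
    · rw [e, hl0] at hchi; exact absurd hchi (lt_irrefl _)
    · exact e
  have hp := chi_sharp_point (k := k) (h := h) hcs hc h0
  have hlt : q * m < zs * cs / c := by
    by_contra hn
    push Not at hn
    have t1 := chi_tangent (c := c) (h := h) (by linarith : (0:ℝ) ≤ k) (q * m) (zs * cs / c)
    have t2 := chi_tangent (c := c) (h := h) (by linarith : (0:ℝ) ≤ k) (q * m) l
    rw [hl0] at t2
    set D := (2 * (q * m) - c - k * c * h * Real.exp (-(q * m * c * h)))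
    rcases le_or_gt 0 D with hD | hD
    · nlinarith [sq_nonneg (l - q * m), mul_nonneg hD (by linarith : 0 ≤ l - q * m)]
    · nlinarith [sq_nonneg (zs * cs / c - q * m), mul_nonneg_of_nonpos_of_nonpos hD.le (by linarith : zs * cs / c - q * m ≤ 0)]
  rw [lt_div_iff₀ hcp] at hlt
  -- the point `zs cs / q`
  have hpst := chi_sharp_point (k := k) (h := h) hcs (hc.trans hcst.le) h0
  have hle : zs * cs / cst ≤ q * mst := by
    by_contra hn
    push Not at hn
    have := chi_pos_of_gt hk hlst (heq ▸ hn)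
    linarith
  rw [div_le_iff₀ hcstp] at hle
  set M := zs * cs / q with hMdef
  have hMq : q * M = zs * cs := by rw [hMdef]; field_simp
  have hHM : HH k h q M ≤ 0 := by
    have : M ≤ cst * mst := by
      rw [hMdef, div_le_iff₀ hq]; linarith
    rcases this.eq_or_lt with e | e
    · rw [e, hHst]
    · rw [← hHst]; exact (HH_mono hk hh hq hq1 e).le
  have hk1 : chiK cs h (M / cs) ≤ 0 := by
    unfold chiK
    unfold HH at hHM
    unfold chi at h0
    have e : M / cs * cs = M := by field_simp
    rw [mul_comm cs (M / cs), e]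
    rw [hMq] at hHM
    have e2 : M / cs = zs / q := by rw [hMdef]; field_simp
    rw [e2]
    have e3 : (zs / q) ^ 2 * q ^ 2 = zs ^ 2 := by field_simp
    have : ((zs / q) ^ 2 - M - 1 - Real.exp (-(M * h))) * q ^ 2 ≤ 0 := by
      have e4 : q * (1 - q) * M = zs * cs - q ^ 2 * M := by rw [← hMq]; ring
      rw [e4] at hHM
      nlinarith
    by_contra hn
    push Not at hn
    have : 0 < ((zs / q) ^ 2 - M - 1 - Real.exp (-(M * h))) * q ^ 2 := by positivity
    linarith
  have h5 := mu_ge hcs hh hmsu (by positivity) hk1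
  rw [div_le_iff₀ hcs] at h5
  have h6 := M_mono hcs hc hh hms hms0 hmu
  have h7 : q * M ≤ q * (c * m) := by
    apply mul_le_mul_of_nonneg_left _ hq.le; linarith
  rw [hMq] at h7
  linarith

lemma ratio_ge {k h q c cst l m mst : ℝ} (hk : 1 < k) (hh : 0 ≤ h) (hq : 0 < q) (hq1 : q < 1)
    (hcstp : 0 < cst) (hcst : cst ≤ c)
    (hl : ∀ z : ℝ, chi k c h z = 0 → z ≤ l)
    (hm0 : chiK c h m = 0) (hmu : ∀ z : ℝ, 0 < z → chiK c h z = 0 → z = m)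
    (hmst0 : chiK cst h mst = 0) (hmst : 0 < mst)
    (hst0 : chi k cst h (q * mst) = 0) : q * m ≤ l := by
  by_contra hn
  push Not at hn
  have h1 := chi_pos_of_gt hk hl hn
  rw [chi_eq_HH q hm0] at h1
  rw [chi_eq_HH q hmst0] at hst0
  have hM := M_mono hcstp hcst hh hmst hmst0 hmu
  rcases hM.eq_or_lt with e | e
  · rw [e] at hst0; linarith
  · have := HH_mono hk hh hq hq1 e; linarith

lemma ratio_nosol {k h q cs zs c : ℝ} {lam1 mu1 : ℝ → ℝ} (hk : 1 < k) (hh : 0 ≤ h) (hq : 0 < q) (hq1 : q < 1)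
    (hcs : 0 < cs) (hz : 0 < zs) (h0 : chi k cs h zs = 0)
    (hlam1 : ∀ c : ℝ, cs ≤ c →
      0 < lam1 c ∧ chi k c h (lam1 c) = 0 ∧ ∀ z : ℝ, chi k c h z = 0 → z ≤ lam1 c)
    (hmu1 : ∀ c : ℝ, 0 < c →
      0 < mu1 c ∧ chiK c h (mu1 c) = 0 ∧ ∀ z : ℝ, 0 < z → chiK c h z = 0 → z = mu1 c)
    (hno : ¬ ∃ c : ℝ, 0 < c ∧ cs ≤ c ∧ lam1 c / mu1 c = q) (hc : cs ≤ c) :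
    q * mu1 c ≤ lam1 c := by
  have hcp : 0 < c := hcs.trans_le hc
  obtain ⟨hlp, hl0, hl⟩ := hlam1 c hc
  obtain ⟨hmp, hm0, hm⟩ := hmu1 c hcp
  by_contra hn
  push Not at hn
  have h1 := chi_pos_of_gt hk hl hn
  rw [chi_eq_HH q hm0] at h1
  have hqq : 0 < q * (1 - q) := mul_pos hq (by linarith)
  set b := max (c * mu1 c) ((k + q ^ 2) / (q * (1 - q))) with hb
  have hbp : 0 < b := lt_of_lt_of_le (by positivity) (le_max_left _ _)
  have hHb : 0 ≤ HH k h q b := by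
    have e1 : Real.exp (-(q * b * h)) ≤ 1 := by
      apply Real.exp_le_one_iff.2
      have : 0 ≤ q * b * h := by positivity
      linarith
    have e2 : Real.exp (-(b * h)) ≤ 1 := by
      apply Real.exp_le_one_iff.2
      have : 0 ≤ b * h := by positivity
      linarith
    have e3 : k + q ^ 2 ≤ q * (1 - q) * b := by
      have := (div_le_iff₀ hqq).1 (le_max_right (c * mu1 c) ((k + q ^ 2) / (q * (1 - q))))
      linarith
    unfold HH
    nlinarith [mul_le_mul_of_nonneg_left e1 (by linarith : (0:ℝ) ≤ k), mul_le_mul_of_nonneg_left e2 (sq_nonneg q)]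
  have hHc : Continuous (HH k h q) := by unfold HH; fun_prop
  obtain ⟨M, hM, hM0⟩ := intermediate_value_Icc (le_max_left (c * mu1 c) ((k + q ^ 2) / (q * (1 - q))))
    hHc.continuousOn ⟨by linarith, hHb⟩
  have hMlt : c * mu1 c < M := by
    rcases hM.1.eq_or_lt with e | e
    · rw [← e] at hM0; linarith
    · exact e
  have hMp : 0 < M := lt_trans (by positivity) hMlt
  set S := Real.sqrt (M + 1 + Real.exp (-(M * h))) with hS
  have hSp : 0 < S := Real.sqrt_pos.2 (by positivity)
  have hS2 : S ^ 2 = M + 1 + Real.exp (-(M * h)) := Real.sq_sqrt (by positivity)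
  set d := M / S with hd
  have hdp : 0 < d := by positivity
  have hSd : S * d = M := by rw [hd]; field_simp
  have hSm : S = mu1 d := by
    apply (hmu1 d hdp).2.2 S hSp
    unfold chiK
    rw [mul_comm d S, hSd, hS2]; ring
  obtain ⟨hmp', hm0', hm'⟩ := hmu1 d hdp
  have hcd : c < d := by
    by_contra hcon
    push Not at hcon
    have := M_mono hdp hcon hh hmp' hm0' hm
    rw [← hSm, mul_comm d, hSd] at this
    linarith
  have hcsd : cs < d := hc.trans_lt hcd
  obtain ⟨hlp', hl0', hl'⟩ := hlam1 d hcsd.le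
  have hchi : chi k d h (q * S) = 0 := by
    have := chi_eq_HH (k := k) q hm0'
    rw [← hSm, mul_comm d, hSd, hM0] at this; linarith
  have hle := hl' _ hchi
  rcases hle.eq_or_lt with e | e
  · apply hno
    refine ⟨d, hdp, hcsd.le, ?_⟩
    rw [← e, ← hSm]; field_simp
  · have hp := chi_sharp_point (k := k) (h := h) hcs hc h0
    have hps := chi_sharp_point_lt (k := k) (h := h) hcs hcsd hz h0
    have h2 : zs * cs / c ≤ lam1 c := by
      by_contra hcon
      push Not at hcon
      have := chi_pos_of_gt hk hl hcon
      linarith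
    rw [div_le_iff₀ hcp] at h2
    have h3 : zs * cs / d < q * S := by
      rw [div_lt_iff₀ hdp]
      calc zs * cs ≤ lam1 c * c := h2
        _ < q * mu1 c * c := by gcongr
        _ = q * (c * mu1 c) := by ring
        _ < q * M := by gcongr
        _ = q * S * d := by rw [← hSd]; ring
    have t1 := chi_tangent (c := d) (h := h) (by linarith : (0:ℝ) ≤ k) (q * S) (zs * cs / d)
    have t2 := chi_tangent (c := d) (h := h) (by linarith : (0:ℝ) ≤ k) (q * S) (lam1 d)
    rw [hl0', hchi] at t2
    rw [hchi] at t1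
    set D := (2 * (q * S) - d - k * d * h * Real.exp (-(q * S * d * h)))
    rcases le_or_gt 0 D with hD | hD
    · have : 0 < (lam1 d - q * S) ^ 2 := by
        have : 0 < lam1 d - q * S := by linarith
        positivity
      have h8 := mul_nonneg hD (by linarith : 0 ≤ lam1 d - q * S)
      linarith
    · have h8 := mul_nonneg_of_nonpos_of_nonpos hD.le (by linarith : zs * cs / d - q * S ≤ 0)
      have h9 := sq_nonneg (zs * cs / d - q * S)
      linarith

lemma anti_of_deriv {F F' : ℝ → ℝ} {a b : ℝ} (hab : a ≤ b) (hc : ContinuousOn F (Icc a b))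
    (hd : ∀ x ∈ Ioo a b, HasDerivAt F (F' x) x) (hn : ∀ x ∈ Ioo a b, F' x ≤ 0) : F b ≤ F a := by
  have : AntitoneOn F (Icc a b) := by
    apply antitoneOn_of_deriv_nonpos (convex_Icc a b) hc
    · intro x hx; rw [interior_Icc] at hx
      exact (hd x hx).differentiableAt.differentiableWithinAt
    · intro x hx; rw [interior_Icc] at hx
      rw [(hd x hx).deriv]; exact hn x hx
  exact this (left_mem_Icc.2 hab) (right_mem_Icc.2 hab) hab

lemma mono_of_deriv {F F' : ℝ → ℝ} {a b : ℝ} (hab : a ≤ b) (hc : ContinuousOn F (Icc a b))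
    (hd : ∀ x ∈ Ioo a b, HasDerivAt F (F' x) x) (hn : ∀ x ∈ Ioo a b, 0 ≤ F' x) : F a ≤ F b := by
  have := anti_of_deriv (F := fun x => - F x) (F' := fun x => - F' x) hab hc.neg
    (fun x hx => (hd x hx).neg) (fun x hx => by have := hn x hx; linarith)
  linarith

lemma santi_of_deriv {F F' : ℝ → ℝ} {a b : ℝ} (hab : a < b) (hc : ContinuousOn F (Icc a b))
    (hd : ∀ x ∈ Ioo a b, HasDerivAt F (F' x) x) (hn : ∀ x ∈ Ioo a b, F' x < 0) : F b < F a := by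
  have : StrictAntiOn F (Icc a b) := by
    apply strictAntiOn_of_deriv_neg (convex_Icc a b) hc
    intro x hx; rw [interior_Icc] at hx
    rw [(hd x hx).deriv]; exact hn x hx
  exact this (left_mem_Icc.2 hab.le) (right_mem_Icc.2 hab.le) hab

lemma smono_of_deriv {F F' : ℝ → ℝ} {a b : ℝ} (hab : a < b) (hc : ContinuousOn F (Icc a b))
    (hd : ∀ x ∈ Ioo a b, HasDerivAt F (F' x) x) (hn : ∀ x ∈ Ioo a b, 0 < F' x) : F a < F b := by
  have := santi_of_deriv (F := fun x => - F x) (F' := fun x => - F' x) hab hc.neg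
    (fun x hx => (hd x hx).neg) (fun x hx => by have := hn x hx; linarith)
  linarith

/-- strict decrease with one exceptional point -/
lemma santi_exc {F F' : ℝ → ℝ} {a b : ℝ} (p : ℝ) (hab : a < b) (hc : ContinuousOn F (Icc a b))
    (hd : ∀ x ∈ Ioo a b, x ≠ p → HasDerivAt F (F' x) x) (hn : ∀ x ∈ Ioo a b, x ≠ p → F' x < 0) :
    F b < F a := by
  by_cases hp : p ∈ Ioo a b
  · have h1 := santi_of_deriv (F := F) (F' := F') hp.1 (hc.mono (Icc_subset_Icc le_rfl hp.2.le))
      (fun x hx => hd x ⟨hx.1, hx.2.trans hp.2⟩ hx.2.ne) (fun x hx => hn x ⟨hx.1, hx.2.trans hp.2⟩ hx.2.ne)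
    have h2 := santi_of_deriv (F := F) (F' := F') hp.2 (hc.mono (Icc_subset_Icc hp.1.le le_rfl))
      (fun x hx => hd x ⟨hp.1.trans hx.1, hx.2⟩ hx.1.ne') (fun x hx => hn x ⟨hp.1.trans hx.1, hx.2⟩ hx.1.ne')
    linarith
  · exact santi_of_deriv hab hc (fun x hx => hd x hx (fun e => hp (e ▸ hx)))
      (fun x hx => hn x hx (fun e => hp (e ▸ hx)))

lemma hasDerivAt_exp_mul (a t : ℝ) : HasDerivAt (fun x => Real.exp (a * x)) (a * Real.exp (a * t)) t := by
  have := ((hasDerivAt_id t).const_mul a).exp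
  simpa [mul_comm] using this

lemma hasDerivAt_exp_mul_fun {F : ℝ → ℝ} {F' : ℝ} (a t : ℝ) (h : HasDerivAt F F' t) :
    HasDerivAt (fun x => Real.exp (a * x) * F x) (Real.exp (a * t) * (F' + a * F t)) t := by
  exact ((hasDerivAt_exp_mul a t).mul h).congr_deriv (by ring)

lemma seq_atBot {f d : ℝ → ℝ} {L : ℝ} (hf : ∀ t, HasDerivAt f (d t) t) (hL : Tendsto f atBot (nhds L))
    {ε : ℝ} (hε : 0 < ε) (N : ℝ) : ∃ t ≤ N, |d t| < ε := by
  have h1 : ∀ᶠ t in atBot, |f t - L| < ε / 2 := by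
    have := (Metric.tendsto_nhds.1 hL) (ε / 2) (by linarith)
    simpa [Real.dist_eq] using this
  obtain ⟨M, hM⟩ := eventually_atBot.1 h1
  set b := min M N with hb
  have hfc : Continuous f := continuous_iff_continuousAt.2 fun t => (hf t).continuousAt
  obtain ⟨x, hx, hxe⟩ := exists_hasDerivAt_eq_slope f d (by linarith : b - 1 < b) hfc.continuousOn
    (fun x _ => hf x)
  refine ⟨x, hx.2.le.trans (min_le_right _ _), ?_⟩
  rw [hxe, show b - (b - 1) = 1 by ring, div_one]
  have h2 := abs_lt.1 (hM b (min_le_left _ _))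
  have h3 := abs_lt.1 (hM (b - 1) (by have := min_le_left M N; linarith))
  rw [abs_lt]; constructor <;> linarith

lemma seq_atTop {f d : ℝ → ℝ} {L : ℝ} (hf : ∀ t, HasDerivAt f (d t) t) (hL : Tendsto f atTop (nhds L))
    {ε : ℝ} (hε : 0 < ε) (N : ℝ) : ∃ t ≥ N, |d t| < ε := by
  have h1 : ∀ t, HasDerivAt (fun x => f (-x)) (- d (-t)) t := by
    intro t
    exact ((hf (-t)).comp t (hasDerivAt_neg t)).congr_deriv (by ring)
  obtain ⟨t, ht, hd⟩ := seq_atBot (L := L) h1 (hL.comp tendsto_neg_atBot_atTop) hε (-N)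
  exact ⟨-t, by linarith, by simpa using hd⟩

/-- no wavefronts with nonpositive speed -/
lemma no_front_nonpos {k c h : ℝ} {f d : ℝ → ℝ} (hk : 1 < k) (hc : c ≤ 0) (hh : 0 ≤ h)
    (hf : ∀ t, HasDerivAt f (d t) t) (hpos : ∀ t, 0 < f t)
    (h0 : Tendsto f atBot (nhds 0))
    (heq : ∀ t, f (t - c * h) < 1 → HasDerivAt d (c * d t + f t - k * f (t - c * h)) t) : False := by
  obtain ⟨σ, hσ⟩ : ∃ σ, σ = - (c * h) := ⟨_, rfl⟩
  have hσ0 : 0 ≤ σ := by rw [hσ]; nlinarith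
  have hfc : Continuous f := continuous_iff_continuousAt.2 fun t => (hf t).continuousAt
  have hlt : ∀ ε > 0, ∃ N, ∀ t ≤ N, f t < ε := by
    intro ε hε
    exact eventually_atBot.1 (h0.eventually_lt_const hε)
  obtain ⟨T0, hT0⟩ := hlt 1 one_pos
  set T1 := T0 - σ with hT1
  set P : ℝ → ℝ := fun x => ∫ r in (0:ℝ)..x, f r with hP
  have hPd : ∀ x, HasDerivAt P (f x) x := fun x =>
    intervalIntegral.integral_hasDerivAt_right (hfc.intervalIntegrable _ _)
      (hfc.stronglyMeasurableAtFilter _ _) hfc.continuousAt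
  have hPmono : ∀ a b, a ≤ b → P a ≤ P b := fun a b hab =>
    mono_of_deriv hab (fun x _ => (hPd x).continuousAt.continuousWithinAt) (fun x _ => hPd x) (fun x _ => (hpos x).le)
  have hPs : ∀ a b, a < b → P a < P b := fun a b hab =>
    smono_of_deriv hab (fun x _ => (hPd x).continuousAt.continuousWithinAt) (fun x _ => hPd x) (fun x _ => (hpos x))
  have hPle : ∀ a ε, (∀ t ≤ a + σ, f t < ε) → P (a + σ) - P a ≤ ε * σ := by
    intro a ε ha
    have := anti_of_deriv (F := fun x => P x - ε * x) (F' := fun x => f x - ε) (by linarith : a ≤ a + σ)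
      (fun x _ => (((hPd x).sub ((hasDerivAt_id x).const_mul ε)).continuousAt).continuousWithinAt)
      (fun x _ => ((hPd x).sub ((hasDerivAt_id x).const_mul ε)).congr_deriv (by ring))
      (fun x hx => by have := ha x hx.2.le; linarith)
    linarith
  set E : ℝ → ℝ := fun t => d t - c * f t - P t + k * P (t + σ) with hE
  have hEd : ∀ t ≤ T1, HasDerivAt E 0 t := by
    intro t ht
    have e : t - c * h = t + σ := by rw [hσ]; ring
    have h1 := heq t (by rw [e]; exact hT0 _ (by linarith))
    rw [e] at h1
    have h2 : HasDerivAt (fun t => P (t + σ)) (f (t + σ)) t := by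
      have := (hPd (t + σ)).comp_add_const t σ
      exact this
    exact (((h1.sub ((hf t).const_mul c)).sub (hPd t)).add (h2.const_mul k)).congr_deriv (by ring)
  have hEc : ∀ s t, s ≤ t → t ≤ T1 → E t = E s := by
    intro s t hst ht
    have hcts : ContinuousOn E (Icc s t) := fun x hx =>
      (hEd x (hx.2.trans ht)).continuousAt.continuousWithinAt
    apply le_antisymm
    · exact anti_of_deriv hst hcts (fun x hx => hEd x (hx.2.le.trans ht)) (fun _ _ => le_rfl)
    · exact mono_of_deriv hst hcts (fun x hx => hEd x (hx.2.le.trans ht)) (fun _ _ => le_rfl)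
  have hneg : ∀ t ≤ T1, d t < 0 := by
    intro t ht
    have key : ∀ δ > 0, d t - c * f t ≤ (k - 1) * (P (t - 1) - P t) + δ := by
      intro δ hδ
      set ε := δ / (1 - c + k * σ) with hε
      have hden : 0 < 1 - c + k * σ := by nlinarith
      have hεp : 0 < ε := by positivity
      have hεe : ε * (1 - c + k * σ) = δ := by rw [hε]; field_simp
      obtain ⟨N, hN⟩ := hlt ε hεp
      obtain ⟨s, hs, hds⟩ := seq_atBot hf h0 hεp (min (N - σ) (t - 1))
      have hs1 : s ≤ N - σ := hs.trans (min_le_left _ _)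
      have hs2 : s ≤ t - 1 := hs.trans (min_le_right _ _)
      have e1 := hEc s t (by linarith) ht
      simp only [hE] at e1
      have e2 := hPle s ε (fun x hx => hN x (by linarith))
      have e3 := hN s (by linarith)
      have e4 := hPmono s (t - 1) hs2
      have e5 := hPmono t (t + σ) (by linarith)
      have e6 := (abs_lt.1 hds).2
      have e7 : -c * f s ≤ -c * ε := mul_le_mul_of_nonneg_left e3.le (by linarith)
      have e8 := mul_le_mul_of_nonneg_left e4 (by linarith : 0 ≤ k - 1)
      have e9 := mul_le_mul_of_nonneg_left e5 (by linarith : 0 ≤ k)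
      have e10 := mul_le_mul_of_nonneg_left e2 (by linarith : 0 ≤ k)
      have : d t - c * f t = d s - c * f s - P s + k * P (s + σ) + P t - k * P (t + σ) := by linarith
      rw [this]
      nlinarith
    have h1 := le_of_forall_pos_le_add key
    have h2 := hPs (t - 1) t (by linarith)
    have h3 : c * f t ≤ 0 := mul_nonpos_of_nonpos_of_nonneg hc (hpos t).le
    nlinarith
  obtain ⟨N, hN⟩ := hlt (f T1) (hpos T1)
  have hm := min_le_left N T1
  have h1 := hN (min N T1) hm
  have h2 := anti_of_deriv (min_le_right N T1) hfc.continuousOn (fun x _ => hf x)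
    (fun x hx => (hneg x hx.2.le).le)
  linarith

/-- upper bound of the logarithmic derivative -/
lemma log_deriv_bound {k c τ T : ℝ} {f d : ℝ → ℝ} (hk : 0 < k) (hτ : 0 ≤ τ)
    (hf : ∀ t, HasDerivAt f (d t) t) (hdc : Continuous d) (hpos : ∀ t ≤ T, 0 < f t)
    (h0 : Tendsto f atBot (nhds 0))
    (heq : ∀ t < T, HasDerivAt d (c * d t + f t - k * f (t - τ)) t) :
    ∃ Y, (∀ t ≤ T, d t ≤ Y * f t) ∧ Y ^ 2 - c * Y - 1 + k * Real.exp (-(Y * τ)) ≤ 0 := by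
  have hfc : Continuous f := continuous_iff_continuousAt.2 fun t => (hf t).continuousAt
  -- a priori bound
  obtain ⟨R, r, hRr, hRr1, hr, hR⟩ : ∃ R r : ℝ, R + r = c ∧ R * r = -1 ∧ r < 0 ∧ 0 < R := by
    have hs : Real.sqrt (c ^ 2 + 4) ^ 2 = c ^ 2 + 4 := Real.sq_sqrt (by positivity)
    have hs0 : 0 < Real.sqrt (c ^ 2 + 4) := Real.sqrt_pos.2 (by positivity)
    refine ⟨(c + Real.sqrt (c ^ 2 + 4)) / 2, (c - Real.sqrt (c ^ 2 + 4)) / 2, by ring, ?_, ?_, ?_⟩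
    · nlinarith
    · by_contra hn; nlinarith
    · by_contra hn; nlinarith
  have hR1 : ∀ a < T, d a ≤ R * f a := by
    intro a ha
    by_contra hn
    push Not at hn
    set w : ℝ → ℝ := fun t => d t - R * f t with hw
    have hwa : 0 < w a := by simp only [hw]; linarith
    obtain ⟨t, hta, hdt⟩ := seq_atBot hf h0 hwa a
    have h1 := anti_of_deriv (F := fun x => Real.exp (-r * x) * w x)
      (F' := fun x => Real.exp (-r * x) * (- k * f (x - τ))) hta
      (by have : Continuous fun x => Real.exp (-r * x) * w x := by fun_prop
          exact this.continuousOn)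
      (fun x hx => by
        have := hasDerivAt_exp_mul_fun (-r) x ((heq x (hx.2.trans ha)).sub ((hf x).const_mul R))
        refine HasDerivAt.congr_deriv this ?_
        congr 1
        have : d x * c = d x * (R + r) := by rw [hRr]
        have h3 : f x * (R * r) = - f x := by rw [hRr1]; ring
        simp only [Pi.sub_apply]
        linear_combination this + h3)
      (fun x hx => by
        have h1 := mul_pos hk (hpos (x - τ) (by linarith [hx.2]))
        have := mul_pos (Real.exp_pos (-r * x)) h1
        linarith)
    have h2 : Real.exp (-r * t) ≤ Real.exp (-r * a) := by
      apply Real.exp_le_exp.2; nlinarith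
    have h3 : w a ≤ w t := by
      have e0 := Real.exp_pos (-r * t)
      have : Real.exp (-r * t) * w a ≤ Real.exp (-r * t) * w t :=
        (mul_le_mul_of_nonneg_right h2 hwa.le).trans h1
      exact le_of_mul_le_mul_left this e0
    have h4 := (abs_lt.1 hdt).2
    have h5 := mul_pos hR (hpos t (hta.trans ha.le))
    simp only [hw] at h3 h4
    linarith
  set S : Set ℝ := (fun t => d t / f t) '' Iio T with hS
  have hSn : S.Nonempty := ⟨_, T - 1, by simp, rfl⟩
  have hSb : BddAbove S := by
    refine ⟨R, ?_⟩
    rintro _ ⟨t, ht, rfl⟩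
    exact (div_le_iff₀ (hpos t (le_of_lt ht))).2 (hR1 t ht)
  set Y := sSup S with hY
  have hYy : ∀ t < T, d t / f t ≤ Y := fun t ht => le_csSup hSb ⟨t, ht, rfl⟩
  have hYd : ∀ t < T, d t ≤ Y * f t := fun t ht => (div_le_iff₀ (hpos t ht.le)).1 (hYy t ht)
  refine ⟨Y, ?_, ?_⟩
  · have hcl : IsClosed {t | d t ≤ Y * f t} := isClosed_le hdc (by fun_prop)
    have : closure (Iio T) ⊆ {t | d t ≤ Y * f t} := closure_minimal (fun t ht => hYd t ht) hcl
    rw [closure_Iio] at this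
    exact fun t ht => this ht
  by_contra hn
  push Not at hn
  set η := Y ^ 2 - c * Y - 1 + k * Real.exp (-(Y * τ)) with hη
  set y : ℝ → ℝ := fun t => d t / f t with hy
  have hyc : ∀ t ≤ T, ContinuousAt y t := fun t ht => hdc.continuousAt.div hfc.continuousAt (hpos t ht).ne'
  have hlag : ∀ t < T, Real.exp (-(Y * τ)) * f t ≤ f (t - τ) := by
    intro t ht
    have h1 := anti_of_deriv (F := fun x => Real.exp (-Y * x) * f x)
      (F' := fun x => Real.exp (-Y * x) * (d x + -Y * f x)) (by linarith : t - τ ≤ t)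
      (by have : Continuous fun x => Real.exp (-Y * x) * f x := by fun_prop
          exact this.continuousOn)
      (fun x hx => hasDerivAt_exp_mul_fun (-Y) x (hf x))
      (fun x hx => mul_nonpos_of_nonneg_of_nonpos (Real.exp_pos _).le (by linarith [hYd x (hx.2.trans ht)]))
    have e : Real.exp (-Y * t) = Real.exp (-Y * (t - τ)) * Real.exp (-(Y * τ)) := by
      rw [← Real.exp_add]; congr 1; ring
    simp only [e, mul_assoc] at h1
    exact le_of_mul_le_mul_left h1 (Real.exp_pos _)
  have hyd : ∀ t < T, HasDerivAt y ((c * d t + f t - k * f (t - τ)) / f t - (d t / f t) ^ 2) t := by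
    intro t ht
    have hp := (hpos t ht.le).ne'
    have := (heq t ht).div (hf t) hp
    refine HasDerivAt.congr_deriv this ?_
    field_simp
  have hq : ∀ t < T, (c * d t + f t - k * f (t - τ)) / f t - (d t / f t) ^ 2
      ≤ -(y t ^ 2 - c * y t - 1 + k * Real.exp (-(Y * τ))) := by
    intro t ht
    have hp := (hpos t ht.le)
    have e : (c * d t + f t - k * f (t - τ)) / f t = c * y t + 1 - k * (f (t - τ) / f t) := by
      simp only [hy]; field_simp
    have h1 : Real.exp (-(Y * τ)) ≤ f (t - τ) / f t := (le_div_iff₀ hp).2 (hlag t ht)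
    have h2 := mul_le_mul_of_nonneg_left h1 hk.le
    rw [e]
    simp only [hy] at *
    linarith
  obtain ⟨δ, hδ, hδq⟩ : ∃ δ > 0, ∀ u, Y - δ < u → u ≤ Y →
      η / 2 < u ^ 2 - c * u - 1 + k * Real.exp (-(Y * τ)) := by
    have hcq : Continuous fun u : ℝ => u ^ 2 - c * u - 1 + k * Real.exp (-(Y * τ)) := by fun_prop
    have h1 : ∀ᶠ u in nhds Y, η / 2 < u ^ 2 - c * u - 1 + k * Real.exp (-(Y * τ)) :=
      hcq.continuousAt.eventually_const_lt (by simp only; linarith)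
    obtain ⟨δ, hδ, h2⟩ := Metric.eventually_nhds_iff.1 h1
    refine ⟨δ, hδ, fun u hu1 hu2 => h2 ?_⟩
    rw [Real.dist_eq, abs_lt]; constructor <;> linarith
  obtain ⟨_, ⟨ts, hts, rfl⟩, hyts⟩ := exists_lt_of_lt_csSup hSn (show Y - δ < sSup S by linarith)
  have hts : ts < T := hts
  have hder : ∀ t < T, Y - δ < y t →
      (c * d t + f t - k * f (t - τ)) / f t - (d t / f t) ^ 2 ≤ - (η / 2) := by
    intro t ht h1
    have := hδq (y t) h1 (hYy t ht)
    linarith [hq t ht]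
  have hstay : ∀ t ≤ ts, Y - δ < y t := by
    intro t ht
    by_contra hcon
    push Not at hcon
    have hcts : ContinuousOn y (Icc t ts) := fun x hx => (hyc x (hx.2.trans hts.le)).continuousWithinAt
    have hcomp : IsCompact (Icc t ts ∩ y ⁻¹' Iic (Y - δ)) :=
      isCompact_Icc.of_isClosed_subset (hcts.preimage_isClosed_of_isClosed isClosed_Icc isClosed_Iic)
        inter_subset_left
    obtain ⟨s0, ⟨hs0, hs0y⟩, hmax⟩ := hcomp.exists_isGreatest ⟨t, ⟨le_rfl, ht⟩, hcon⟩
    have h1 := anti_of_deriv hs0.2 (hcts.mono (Icc_subset_Icc hs0.1 le_rfl))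
      (fun x hx => hyd x (hx.2.trans hts)) (fun x hx => by
        have : Y - δ < y x := by
          by_contra hc2
          push Not at hc2
          have := hmax ⟨⟨hs0.1.trans hx.1.le, hx.2.le⟩, hc2⟩
          linarith [hx.1]
        linarith [hder x (hx.2.trans hts) this])
    have h2 : y s0 ≤ Y - δ := hs0y
    have h3 : Y - δ < y ts := hyts
    linarith
  have hts2 : y ts ≤ Y := hYy ts hts
  set t := ts - (2 * (δ + 1)) / η with ht
  have htt : t ≤ ts := by
    have : 0 < (2 * (δ + 1)) / η := by positivity
    linarith
  have h1 := anti_of_deriv (F := fun x => y x + (η / 2) * x)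
    (F' := fun t => (c * d t + f t - k * f (t - τ)) / f t - (d t / f t) ^ 2 + (η / 2) * 1) htt
    (fun x hx => ((hyc x (hx.2.trans hts.le)).add (by fun_prop)).continuousWithinAt)
    (fun x hx => (hyd x (hx.2.trans hts)).add ((hasDerivAt_id x).const_mul (η / 2)))
    (fun x hx => by linarith [hder x (hx.2.trans hts) (hstay x hx.2.le)])
  have h2 := hYy t (htt.trans_lt hts)
  have e : η / 2 * t = η / 2 * ts - (δ + 1) := by rw [ht]; field_simp
  simp only [hy] at *
  linarith

/-- a solution of the linear equation to the left of `T` -/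
structure LS (k c τ T : ℝ) (f d : ℝ → ℝ) : Prop where
  hf : ∀ t, HasDerivAt f (d t) t
  hdc : Continuous d
  heq : ∀ t < T, HasDerivAt d (c * d t + f t - k * f (t - τ)) t

lemma LS.fc {k c τ T : ℝ} {f d : ℝ → ℝ} (H : LS k c τ T f d) : Continuous f :=
  continuous_iff_continuousAt.2 fun t => (H.hf t).continuousAt

lemma LS.comb {k c τ T : ℝ} {f d e de : ℝ → ℝ} (H : LS k c τ T f d) (H2 : LS k c τ T e de) (α β : ℝ) :
    LS k c τ T (fun t => α * f t + β * e t) (fun t => α * d t + β * de t) where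
  hf t := ((H.hf t).const_mul α).add ((H2.hf t).const_mul β)
  hdc := by have := H.hdc; have := H2.hdc; fun_prop
  heq t ht := (((H.heq t ht).const_mul α).add ((H2.heq t ht).const_mul β)).congr_deriv (by ring)

lemma lag_le {l τ t : ℝ} {f d : ℝ → ℝ} (hf : ∀ t, HasDerivAt f (d t) t) (hτ : 0 ≤ τ)
    (hv : ∀ s, t - τ ≤ s → s < t → d s ≤ l * f s) : Real.exp (-(l * τ)) * f t ≤ f (t - τ) := by
  have hfc : Continuous f := continuous_iff_continuousAt.2 fun t => (hf t).continuousAt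
  have h1 := anti_of_deriv (F := fun x => Real.exp (-l * x) * f x)
    (F' := fun x => Real.exp (-l * x) * (d x + -l * f x)) (by linarith : t - τ ≤ t)
    (by have : Continuous fun x => Real.exp (-l * x) * f x := by fun_prop
        exact this.continuousOn)
    (fun x hx => hasDerivAt_exp_mul_fun (-l) x (hf x))
    (fun x hx => mul_nonpos_of_nonneg_of_nonpos (Real.exp_pos _).le (by linarith [hv x hx.1.le hx.2]))
  have e : Real.exp (-l * t) = Real.exp (-l * (t - τ)) * Real.exp (-(l * τ)) := by
    rw [← Real.exp_add]; congr 1; ring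
  simp only [e, mul_assoc] at h1
  exact le_of_mul_le_mul_left h1 (Real.exp_pos _)

lemma LS.window {k c τ T l t0 t1 : ℝ} {f d : ℝ → ℝ} (H : LS k c τ T f d) (hk : 0 < k) (hτ : 0 ≤ τ)
    (hl : l ^ 2 - c * l - 1 + k * Real.exp (-(l * τ)) = 0) (h01 : t0 ≤ t1) (h1T : t1 ≤ T)
    (hv : ∀ s, t0 - τ ≤ s → s < t1 → d s ≤ l * f s) :
    Real.exp ((l - c) * t0) * (l * f t0 - d t0) ≤ Real.exp ((l - c) * t1) * (l * f t1 - d t1) := by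
  have hfc := H.fc
  have hdc := H.hdc
  refine mono_of_deriv (F := fun x => Real.exp ((l - c) * x) * (l * f x - d x))
    (F' := fun x => Real.exp ((l - c) * x) * (k * (f (x - τ) - Real.exp (-(l * τ)) * f x))) h01 ?_ ?_ ?_
  · have : Continuous fun x => Real.exp ((l - c) * x) * (l * f x - d x) := by fun_prop
    exact this.continuousOn
  · intro x hx
    have h1 : HasDerivAt (fun x => l * f x - d x) (l * d x - (c * d x + f x - k * f (x - τ))) x :=
      ((H.hf x).const_mul l).sub (H.heq x (hx.2.trans_le h1T))
    refine (hasDerivAt_exp_mul_fun (l - c) x h1).congr_deriv ?_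
    congr 1
    linear_combination (f x) * hl
  · intro x hx
    have := lag_le (l := l) (t := x) H.hf hτ (fun s hs1 hs2 => hv s (by linarith [hx.1]) (hs2.trans hx.2))
    exact mul_nonneg (Real.exp_pos _).le (mul_nonneg hk.le (by linarith))

lemma LS.inv {k c τ T l t0 : ℝ} {f d : ℝ → ℝ} (H : LS k c τ T f d) (hk : 0 < k) (hτ : 0 ≤ τ)
    (hl : l ^ 2 - c * l - 1 + k * Real.exp (-(l * τ)) = 0)
    (hv : ∀ s, t0 - τ ≤ s → s ≤ t0 → d s < l * f s) : ∀ t, t0 ≤ t → t ≤ T → d t < l * f t := by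
  intro t ht htT
  by_contra hcon
  push Not at hcon
  have hfc := H.fc
  have hdc := H.hdc
  have hcl : IsClosed {s | l * f s ≤ d s} := isClosed_le (by fun_prop) hdc
  have hcomp : IsCompact (Icc t0 t ∩ {s | l * f s ≤ d s}) := isCompact_Icc.inter_right hcl
  obtain ⟨s0, ⟨hs0, hs0y⟩, hmin⟩ := hcomp.exists_isLeast ⟨t, ⟨ht, le_rfl⟩, hcon⟩
  have h1 : ∀ s, t0 - τ ≤ s → s < s0 → d s < l * f s := by
    intro s h1 h2
    rcases le_total s t0 with h3 | h3
    · exact hv s h1 h3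
    · by_contra h4
      push Not at h4
      have := hmin ⟨⟨h3, h2.le.trans hs0.2⟩, h4⟩
      linarith
  have h2 := H.window hk hτ hl hs0.1 (hs0.2.trans htT) (fun s hs1 hs2 => (h1 s hs1 hs2).le)
  have h3 := hv t0 (by linarith) le_rfl
  have h4 := mul_pos (Real.exp_pos ((l - c) * t0)) (sub_pos.2 h3)
  have h5 : l * f s0 ≤ d s0 := hs0y
  have h6 : Real.exp ((l - c) * s0) * (l * f s0 - d s0) ≤ 0 :=
    mul_nonpos_of_nonneg_of_nonpos (Real.exp_pos _).le (by linarith)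
  linarith

/-- the comparison solution built from the two roots -/
lemma exists_e {k c τ l1 l2 : ℝ} (hl1 : l1 ^ 2 - c * l1 - 1 + k * Real.exp (-(l1 * τ)) = 0) (h20 : 0 < l2)
    (h : (l2 < l1 ∧ l2 ^ 2 - c * l2 - 1 + k * Real.exp (-(l2 * τ)) = 0) ∨
      (l2 = l1 ∧ 2 * l1 - c - k * τ * Real.exp (-(l1 * τ)) = 0)) :
    ∃ e : ℝ → ℝ, e 0 = 0 ∧ (∀ t ≤ 0, 0 ≤ e t) ∧ Tendsto e atBot (nhds 0) ∧
      ∀ T, LS k c τ T e (fun t => l1 * e t - Real.exp (l2 * t)) := by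
  rcases h with ⟨hlt, h2⟩ | ⟨rfl, h2⟩
  · have hp : 0 < l1 - l2 := by linarith
    have hex : ∀ a : ℝ, 0 < a → Tendsto (fun t : ℝ => Real.exp (a * t)) atBot (nhds 0) := fun a ha =>
      Real.tendsto_exp_atBot.comp (tendsto_id.const_mul_atBot ha)
    refine ⟨fun t => (l1 - l2)⁻¹ * (Real.exp (l2 * t) - Real.exp (l1 * t)), by simp, ?_, ?_, ?_⟩
    · intro t ht
      have : Real.exp (l1 * t) ≤ Real.exp (l2 * t) := Real.exp_le_exp.2 (by nlinarith)
      have := inv_pos.2 hp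
      exact mul_nonneg this.le (by linarith)
    · have := ((hex l2 h20).sub (hex l1 (h20.trans hlt))).const_mul (l1 - l2)⁻¹
      simpa using this
    · intro T
      have hd : ∀ t, HasDerivAt (fun t => (l1 - l2)⁻¹ * (Real.exp (l2 * t) - Real.exp (l1 * t)))
          ((l1 - l2)⁻¹ * (l2 * Real.exp (l2 * t) - l1 * Real.exp (l1 * t))) t := fun t =>
        ((hasDerivAt_exp_mul l2 t).sub (hasDerivAt_exp_mul l1 t)).const_mul _
      have he : ∀ t, l1 * ((l1 - l2)⁻¹ * (Real.exp (l2 * t) - Real.exp (l1 * t))) - Real.exp (l2 * t)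
          = (l1 - l2)⁻¹ * (l2 * Real.exp (l2 * t) - l1 * Real.exp (l1 * t)) := by
        intro t; field_simp; ring
      simp only [he]
      refine ⟨hd, by fun_prop, ?_⟩
      intro t _
      refine ((((hasDerivAt_exp_mul l2 t).const_mul l2).sub
        ((hasDerivAt_exp_mul l1 t).const_mul l1)).const_mul _).congr_deriv ?_
      have e1 : Real.exp (l1 * (t - τ)) = Real.exp (l1 * t) * Real.exp (-(l1 * τ)) := by
        rw [← Real.exp_add]; congr 1; ring
      have e2 : Real.exp (l2 * (t - τ)) = Real.exp (l2 * t) * Real.exp (-(l2 * τ)) := by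
        rw [← Real.exp_add]; congr 1; ring
      rw [e1, e2]
      linear_combination (l1 - l2)⁻¹ * (Real.exp (l2 * t) * h2 - Real.exp (l1 * t) * hl1)
  · refine ⟨fun t => - t * Real.exp (l2 * t), by simp, ?_, ?_, ?_⟩
    · intro t ht
      exact mul_nonneg (by linarith) (Real.exp_pos _).le
    · have h1 : Tendsto (fun x : ℝ => x ^ 1 * Real.exp (-x)) atTop (nhds 0) :=
        Real.tendsto_pow_mul_exp_neg_atTop_nhds_zero 1
      have h3 : Tendsto (fun t : ℝ => -(l2 * t)) atBot atTop :=
        tendsto_neg_atBot_atTop.comp (tendsto_id.const_mul_atBot h20)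
      have h4 := (h1.comp h3).const_mul l2⁻¹
      rw [mul_zero] at h4
      refine h4.congr fun t => ?_
      simp only [Function.comp, neg_neg, pow_one]
      field_simp
    · intro T
      have hd : ∀ t, HasDerivAt (fun t => - t * Real.exp (l2 * t))
          (l2 * (- t * Real.exp (l2 * t)) - Real.exp (l2 * t)) t := fun t =>
        (((hasDerivAt_id t).neg).mul (hasDerivAt_exp_mul l2 t)).congr_deriv (by simp; ring)
      refine ⟨hd, by fun_prop, ?_⟩
      intro t _
      refine (((hd t).const_mul l2).sub (hasDerivAt_exp_mul l2 t)).congr_deriv ?_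
      have e1 : Real.exp (l2 * (t - τ)) = Real.exp (l2 * t) * Real.exp (-(l2 * τ)) := by
        rw [← Real.exp_add]; congr 1; ring
      rw [e1]
      linear_combination (-t * Real.exp (l2 * t)) * hl1 - Real.exp (l2 * t) * h2

/-- rigidity -/
lemma LS.rigid {k c τ T l1 l2 : ℝ} {f d e : ℝ → ℝ} (H : LS k c τ T f d) (hk : 0 < k) (hτ : 0 ≤ τ)
    (hl : l1 ^ 2 - c * l1 - 1 + k * Real.exp (-(l1 * τ)) = 0)
    (He : LS k c τ T e (fun t => l1 * e t - Real.exp (l2 * t)))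
    (hκ : 0 ≤ l1 + l2 - c)
    (hv : ∀ t ≤ T, d t ≤ l1 * f t) :
    ∃ V, 0 ≤ V ∧ ∀ t ≤ T, d t = l1 * f t - V * Real.exp (l2 * t) := by
  set a : ℝ → ℝ := fun t => (l1 * f t - d t) * Real.exp (-(l2 * t)) with ha
  have haE : ∀ t, a t * Real.exp (l2 * t) = l1 * f t - d t := by
    intro t; simp only [ha]; rw [mul_assoc, ← Real.exp_add]; simp
  have ha0 : ∀ t ≤ T, 0 ≤ a t := fun t ht => mul_nonneg (by linarith [hv t ht]) (Real.exp_pos _).le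
  have hlow : ∀ M t, a t > M → M * Real.exp (l2 * t) < l1 * f t - d t := by
    intro M t h; rw [← haE]; exact mul_lt_mul_of_pos_right h (Real.exp_pos _)
  have hup : ∀ M t, a t < M → l1 * f t - d t < M * Real.exp (l2 * t) := by
    intro M t h; rw [← haE]; exact mul_lt_mul_of_pos_right h (Real.exp_pos _)
  set S : Set ℝ := a '' Iic T with hS
  have hSn : S.Nonempty := ⟨_, T, by simp, rfl⟩
  have hSb : BddBelow S := ⟨0, by rintro _ ⟨t, ht, rfl⟩; exact ha0 t ht⟩
  set m := sInf S with hm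
  have hma : ∀ t ≤ T, m ≤ a t := fun t ht => csInf_le hSb ⟨t, ht, rfl⟩
  have hm0 : 0 ≤ m := le_csInf hSn (by rintro _ ⟨t, ht, rfl⟩; exact ha0 t ht)
  have hfar : ∀ ε > 0, ∀ T' ≤ T, ∃ t ≤ T', a t < m + ε := by
    intro ε hε T' hT'
    by_contra hcon
    push Not at hcon
    have h1 := (H.comb He 1 (-(m + ε / 2))).inv (t0 := T') hk hτ hl (fun s _ hs => by
      have := hlow (m + ε / 2) s (by linarith [hcon s hs])
      linarith)
    obtain ⟨_, ⟨t, ht, rfl⟩, hlt⟩ := exists_lt_of_csInf_lt hSn (show sInf S < m + ε / 2 by linarith)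
    rcases le_total t T' with h | h
    · linarith [hcon t h]
    · have h2 := h1 t h ht
      have h3 := hup _ t hlt
      linarith
  have hall : ∀ x ≤ T, a x ≤ m := by
    intro x hx
    apply le_of_forall_pos_lt_add
    intro ε hε
    obtain ⟨t, ht, hat⟩ := hfar (ε * Real.exp (-((l1 + l2 - c) * τ))) (mul_pos hε (Real.exp_pos _)) x hx
    have hwin : ∀ s, t - τ ≤ s → s ≤ t → a s < m + ε := by
      intro s hs1 hs2
      have h1 := (H.comb He 1 (-m)).window (t0 := s) (t1 := t) hk hτ hl hs2 (ht.trans hx) (fun r _ hr => by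
        have h2 := hma r (by linarith)
        have h3 := mul_le_mul_of_nonneg_right h2 (Real.exp_pos (l2 * r)).le
        rw [haE] at h3; linarith)
      have h2 : ∀ r, Real.exp ((l1 - c) * r) * (l1 * (1 * f r + -m * e r) - (1 * d r + -m * (l1 * e r - Real.exp (l2 * r))))
          = Real.exp ((l1 + l2 - c) * r) * (a r - m) := by
        intro r
        have e1 : Real.exp ((l1 + l2 - c) * r) = Real.exp ((l1 - c) * r) * Real.exp (l2 * r) := by
          rw [← Real.exp_add]; congr 1; ring
        rw [e1]
        linear_combination - Real.exp ((l1 - c) * r) * haE r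
      rw [h2, h2] at h1
      have e3 : Real.exp ((l1 + l2 - c) * t) * Real.exp (-((l1 + l2 - c) * τ)) ≤ Real.exp ((l1 + l2 - c) * s) := by
        rw [← Real.exp_add]; apply Real.exp_le_exp.2; nlinarith
      have e4 : Real.exp ((l1 + l2 - c) * t) * (a t - m)
          < Real.exp ((l1 + l2 - c) * t) * (ε * Real.exp (-((l1 + l2 - c) * τ))) :=
        mul_lt_mul_of_pos_left (by linarith) (Real.exp_pos _)
      have e5 := mul_le_mul_of_nonneg_left e3 hε.le
      have e6 : Real.exp ((l1 + l2 - c) * s) * (a s - m) < Real.exp ((l1 + l2 - c) * s) * ε := by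
        calc _ ≤ _ := h1
          _ < _ := e4
          _ = ε * (Real.exp ((l1 + l2 - c) * t) * Real.exp (-((l1 + l2 - c) * τ))) := by ring
          _ ≤ _ := e5
          _ = _ := by ring
      have := lt_of_mul_lt_mul_left e6 (Real.exp_pos _).le
      linarith
    have h1 := (H.comb He (-1) (m + ε)).inv (t0 := t) hk hτ hl (fun s hs1 hs2 => by
      have := hup (m + ε) s (hwin s hs1 hs2)
      linarith) x ht hx
    have h2 : a x * Real.exp (l2 * x) < (m + ε) * Real.exp (l2 * x) := by rw [haE]; linarith
    exact lt_of_mul_lt_mul_right h2 (Real.exp_pos _).le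
  refine ⟨m, hm0, fun t ht => ?_⟩
  have : a t = m := le_antisymm (hall t ht) (hma t ht)
  have h2 := haE t
  rw [this] at h2
  linarith

/-- unimodality -/
lemma unimod {T l1 l2 V : ℝ} {f d : ℝ → ℝ} (hf : ∀ t, HasDerivAt f (d t) t) (hl1 : 0 < l1) (hl2 : 0 < l2)
    (hV : 0 ≤ V) (hpos : V = 0 → ∀ t ≤ T, 0 < f t) (hd : ∀ t ≤ T, d t = l1 * f t - V * Real.exp (l2 * t)) :
    ∀ a t, a < t → t ≤ T → d a ≤ 0 → d t < 0 := by
  intro a t hat htT hda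
  have hfc : Continuous f := continuous_iff_continuousAt.2 fun t => (hf t).continuousAt
  have hV0 : 0 < V := by
    rcases hV.lt_or_eq with h | h
    · exact h
    · exfalso
      have h1 := hd a (by linarith)
      have h2 := mul_pos hl1 (hpos h.symm a (by linarith))
      rw [← h] at h1; linarith
  have h1 := santi_of_deriv (F := fun x => Real.exp (-l1 * x) * (l1 * f x - V * Real.exp (l2 * x)))
    (F' := fun x => Real.exp (-l1 * x) * (l1 * d x - V * (l2 * Real.exp (l2 * x))
      + -l1 * (l1 * f x - V * Real.exp (l2 * x)))) hat
    (by have : Continuous fun x => Real.exp (-l1 * x) * (l1 * f x - V * Real.exp (l2 * x)) := by fun_prop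
        exact this.continuousOn)
    (fun x _ => hasDerivAt_exp_mul_fun (-l1) x
      (((hf x).const_mul l1).sub ((hasDerivAt_exp_mul l2 x).const_mul V)))
    (fun x hx => by
      have h2 := hd x (by linarith [hx.2])
      have h3 := mul_pos hV0 (mul_pos hl2 (Real.exp_pos (l2 * x)))
      have : Real.exp (-l1 * x) * (V * (l2 * Real.exp (l2 * x))) > 0 := mul_pos (Real.exp_pos _) h3
      rw [h2]; linarith)
  simp only [← hd a (by linarith), ← hd t htT] at h1
  have h2 : Real.exp (-l1 * a) * d a ≤ 0 := mul_nonpos_of_nonneg_of_nonpos (Real.exp_pos _).le hda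
  by_contra h3
  push Not at h3
  have := mul_nonneg (Real.exp_pos (-l1 * t)).le h3
  linarith

lemma left_pos {c a t0 : ℝ} {f d : ℝ → ℝ} (hf : ∀ t, HasDerivAt f (d t) t) (hdc : Continuous d)
    (hd0 : d t0 ≤ 0) (ha : a < t0)
    (hG : ∀ t ∈ Ioo a t0, ∃ G, HasDerivAt d (c * d t + G) t ∧ 0 < G) :
    f t0 < f a := by
  have hfc : Continuous f := continuous_iff_continuousAt.2 fun t => (hf t).continuousAt
  have key : ∀ s, a ≤ s → s < t0 → d s < 0 := by
    intro s hs hst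
    have h1 := smono_of_deriv (F := fun x => Real.exp (-c * x) * d x)
      (F' := fun x => Real.exp (-c * x) * (deriv d x + -c * d x)) hst
      (by have : Continuous fun x => Real.exp (-c * x) * d x := by fun_prop
          exact this.continuousOn)
      (fun x hx => by
        obtain ⟨G, h1, _⟩ := hG x ⟨hs.trans_lt hx.1, hx.2⟩
        exact hasDerivAt_exp_mul_fun (-c) x h1.differentiableAt.hasDerivAt)
      (fun x hx => by
        obtain ⟨G, h1, h2⟩ := hG x ⟨hs.trans_lt hx.1, hx.2⟩
        rw [h1.deriv]
        exact mul_pos (Real.exp_pos _) (by linarith))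
    have h2 : Real.exp (-c * t0) * d t0 ≤ 0 := mul_nonpos_of_nonneg_of_nonpos (Real.exp_pos _).le hd0
    by_contra h3
    push Not at h3
    have := mul_nonneg (Real.exp_pos (-c * s)).le h3
    linarith
  exact santi_of_deriv ha hfc.continuousOn (fun x _ => hf x) (fun x hx => key x hx.1.le hx.2)

lemma left_neg {c a t0 : ℝ} {f d : ℝ → ℝ} (hf : ∀ t, HasDerivAt f (d t) t) (hdc : Continuous d)
    (hd0 : 0 ≤ d t0) (ha : a < t0)
    (hG : ∀ t ∈ Ioo a t0, ∃ G, HasDerivAt d (c * d t + G) t ∧ G < 0) :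
    f a < f t0 := by
  have := left_pos (c := c) (f := fun t => - f t) (d := fun t => - d t) (fun t => (hf t).neg) hdc.neg
    (by simpa using hd0) ha (fun t ht => by
      obtain ⟨G, h1, h2⟩ := hG t ht
      exact ⟨-G, h1.neg.congr_deriv (by ring), by linarith⟩)
  linarith

lemma ev_left {P : ℝ → Prop} {t0 b : ℝ} (h : ∀ᶠ t in nhds t0, P t) (hb : b < t0) :
    ∃ a, b ≤ a ∧ a < t0 ∧ ∀ t, a < t → t ≤ t0 → P t := by
  obtain ⟨δ, hδ, h1⟩ := Metric.eventually_nhds_iff.1 h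
  refine ⟨max b (t0 - δ), le_max_left _ _, max_lt hb (by linarith), fun t h2 h3 => h1 ?_⟩
  rw [Real.dist_eq, abs_lt]
  have := le_max_right b (t0 - δ)
  constructor <;> linarith

lemma ev_right {P : ℝ → Prop} {t0 : ℝ} (h : ∀ᶠ t in nhds t0, P t) :
    ∃ δ > 0, ∀ t, t0 ≤ t → t < t0 + δ → P t := by
  obtain ⟨δ, hδ, h1⟩ := Metric.eventually_nhds_iff.1 h
  refine ⟨δ, hδ, fun t h2 h3 => h1 ?_⟩
  rw [Real.dist_eq, abs_lt]
  constructor <;> linarith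

section
variable {k c τ : ℝ} {f d : ℝ → ℝ}

lemma nr_stepA (hf : ∀ t, HasDerivAt f (d t) t) (hdc : Continuous d) (hτ : 0 ≤ τ)
    (h2 : Tendsto f atTop (nhds 2))
    (H2 : ∀ t, τ < t → 1 < f (t - τ) → HasDerivAt d (c * d t + f t - (4 - f (t - τ))) t)
    (H3 : ∀ t, τ < t → f (t - τ) < 1 → ∃ F, HasDerivAt d (c * d t + f t - F) t ∧ (f t ≤ f (t - τ) → f t < F))
    {t1 δ : ℝ} (ht1 : 0 ≤ t1) (hft1 : f t1 ≤ 1) (hgt : ∀ t, 0 < t → t < t1 → 1 < f t)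
    (hlt3 : ∀ t, 0 ≤ t → t ≤ t1 → f t < 3) (hδ : 0 < δ)
    (hneg : ∀ t, t1 < t → t < t1 + δ → d t < 0) (hnegτ : ∀ t, t1 < t → t ≤ τ → d t < 0) : False := by
  have hfc : Continuous f := continuous_iff_continuousAt.2 fun t => (hf t).continuousAt
  obtain ⟨t, ht, hdt⟩ : ∃ t, t1 < t ∧ 0 ≤ d t := by
    by_contra hcon
    push Not at hcon
    have h1 : ∀ᶠ t in atTop, 1 < f t := h2.eventually_const_lt (by norm_num)
    obtain ⟨t, h3, h4⟩ := (h1.and (eventually_gt_atTop t1)).exists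
    have := anti_of_deriv h4.le hfc.continuousOn (fun x _ => hf x) (fun x hx => (hcon x hx.1).le)
    linarith
  have htδ : t1 + δ / 2 ≤ t := by
    by_contra hcon
    push Not at hcon
    have := hneg t ht (by linarith)
    linarith
  have hcl : IsClosed {s | 0 ≤ d s} := isClosed_le continuous_const hdc
  obtain ⟨t2, ⟨ht2, hdt2⟩, hmin⟩ := (isCompact_Icc.inter_right hcl).exists_isLeast
    (⟨t, ⟨htδ, le_rfl⟩, hdt⟩ : (Icc (t1 + δ / 2) t ∩ {s | 0 ≤ d s}).Nonempty)
  have hdt2 : 0 ≤ d t2 := hdt2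
  have hn : ∀ s, t1 < s → s < t2 → d s < 0 := by
    intro s hs1 hs2
    rcases lt_or_ge s (t1 + δ / 2) with h | h
    · exact hneg s hs1 (by linarith)
    · by_contra h4
      push Not at h4
      have := hmin ⟨⟨h, hs2.le.trans ht2.2⟩, h4⟩
      linarith
  have ht12 : t1 < t2 := by linarith [ht2.1]
  have hτ2 : τ < t2 := by
    by_contra h4
    push Not at h4
    have := hnegτ t2 ht12 h4
    linarith
  have hanti : ∀ r s, t1 ≤ r → r < s → s ≤ t2 → f s < f r := fun r s hr hrs hs =>
    santi_of_deriv hrs hfc.continuousOn (fun x _ => hf x) (fun x hx => hn x (hr.trans_lt hx.1) (hx.2.trans_le hs))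
  obtain ⟨b, hb1, hbτ, hb2⟩ : ∃ b, t1 < b ∧ τ < b ∧ b < t2 := by
    obtain ⟨b, h1, h2⟩ := exists_between (max_lt ht12 hτ2)
    exact ⟨b, (le_max_left _ _).trans_lt h1, (le_max_right _ _).trans_lt h1, h2⟩
  have hex : ∀ x ∈ Ioo b t2, x ≠ t1 + τ → ∃ F, HasDerivAt d (c * d x + f x - F) x ∧ f x < F := by
    intro x hx hxne
    have hx1 : t1 < x := hb1.trans hx.1
    have hxτ : τ < x := hbτ.trans hx.1
    have hfx : f x < 1 := (hanti t1 x le_rfl hx1 hx.2.le).trans_le hft1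
    rcases lt_or_ge (x - τ) t1 with h | h
    · have h5 := hgt (x - τ) (by linarith) h
      have h6 := hlt3 (x - τ) (by linarith) h.le
      exact ⟨_, H2 x hxτ h5, by linarith⟩
    · have h' : t1 < x - τ := lt_of_le_of_ne h (fun e => hxne (by linarith))
      have h5 : f (x - τ) < 1 := (hanti t1 (x - τ) le_rfl h' (by linarith [hx.2])).trans_le hft1
      obtain ⟨F, hF1, hF2⟩ := H3 x hxτ h5
      refine ⟨F, hF1, hF2 ?_⟩
      rcases hτ.lt_or_eq with h6 | h6
      · exact (hanti (x - τ) x h (by linarith) hx.2.le).le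
      · rw [← h6, sub_zero]
  have h1 := santi_exc (F := fun x => Real.exp (-c * x) * d x)
      (F' := fun x => Real.exp (-c * x) * (deriv d x + -c * d x)) (t1 + τ) hb2
      (by have : Continuous fun x => Real.exp (-c * x) * d x := by fun_prop
          exact this.continuousOn)
      (fun x hx hne => by
        obtain ⟨G, h1, _⟩ := hex x hx hne
        exact hasDerivAt_exp_mul_fun (-c) x h1.differentiableAt.hasDerivAt)
      (fun x hx hne => by
        obtain ⟨G, h1, h2⟩ := hex x hx hne
        rw [h1.deriv]
        exact mul_neg_of_pos_of_neg (Real.exp_pos _) (by linarith))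
  have h3 : Real.exp (-c * b) * d b < 0 := mul_neg_of_pos_of_neg (Real.exp_pos _) (hn b hb1 hb2)
  have h4 := mul_nonneg (Real.exp_pos (-c * t2)).le hdt2
  linarith

lemma no_return (hf : ∀ t, HasDerivAt f (d t) t) (hdc : Continuous d) (hτ : 0 ≤ τ)
    (hk1 : 1 < k) (hk3 : k < 3) (f0 : f 0 = 1) (hle : ∀ t ≤ 0, f t ≤ 1)
    (U : ∀ a t, a < t → t ≤ τ → d a ≤ 0 → d t < 0)
    (h2 : Tendsto f atTop (nhds 2)) (hor : 0 < d 0 ∨ 0 < τ)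
    (H1 : ∀ t < τ, HasDerivAt d (c * d t + f t - k * f (t - τ)) t)
    (H2 : ∀ t, τ < t → 1 < f (t - τ) → HasDerivAt d (c * d t + f t - (4 - f (t - τ))) t)
    (H3 : ∀ t, τ < t → f (t - τ) < 1 → ∃ F, HasDerivAt d (c * d t + f t - F) t ∧ (f t ≤ f (t - τ) → f t < F)) :
    ∀ t > 0, 1 < f t := by
  have hfc : Continuous f := continuous_iff_continuousAt.2 fun t => (hf t).continuousAt
  intro t ht
  by_contra hft
  push Not at hft
  rcases le_or_gt (d 0) 0 with hd0 | hd0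
  · have hτ0 : 0 < τ := by
      rcases hor with h | h
      · linarith
      · exact h
    exact nr_stepA hf hdc hτ h2 H2 H3 (t1 := 0) (δ := τ) le_rfl f0.le (fun t h1 h2 => by linarith)
      (fun t h1 h2 => by rw [le_antisymm h2 h1, f0]; norm_num) hτ0
      (fun t h1 h2 => U 0 t h1 (by linarith) hd0) (fun t h1 h2 => U 0 t h1 h2 hd0)
  · obtain ⟨δ0, hδ0, hδd⟩ := ev_right (hdc.continuousAt.eventually_const_lt hd0)
    have hg0 : ∀ t, 0 < t → t < δ0 → 1 < f t := by
      intro t h1 h2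
      rw [← f0]
      exact smono_of_deriv h1 hfc.continuousOn (fun x _ => hf x) (fun x hx => hδd x hx.1.le (by linarith [hx.2]))
    have htδ : δ0 / 2 ≤ t := by
      by_contra hcon
      push Not at hcon
      have := hg0 t ht (by linarith)
      linarith
    have hcl : IsClosed {s | f s ≤ 1} := isClosed_le hfc continuous_const
    obtain ⟨t1, ⟨ht1, hft1⟩, hmin⟩ := (isCompact_Icc.inter_right hcl).exists_isLeast
      (⟨t, ⟨htδ, le_rfl⟩, hft⟩ : (Icc (δ0 / 2) t ∩ {s | f s ≤ 1}).Nonempty)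
    have hft1 : f t1 ≤ 1 := hft1
    have ht10 : 0 < t1 := by linarith [ht1.1]
    have hgt : ∀ s, 0 < s → s < t1 → 1 < f s := by
      intro s hs1 hs2
      rcases lt_or_ge s (δ0 / 2) with h | h
      · exact hg0 s hs1 (by linarith)
      · by_contra h4
        push Not at h4
        have := hmin ⟨⟨h, hs2.le.trans ht1.2⟩, h4⟩
        linarith
    obtain ⟨t0, ht0, hmax⟩ := isCompact_Icc.exists_isMaxOn (nonempty_Icc.2 ht10.le) hfc.continuousOn
    have hmax' : ∀ s, 0 ≤ s → s ≤ t1 → f s ≤ f t0 := fun s h1 h2 => hmax ⟨h1, h2⟩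
    have hft0 : 1 < f t0 := (hgt (t1 / 2) (by linarith) (by linarith)).trans_le (hmax' _ (by linarith) (by linarith))
    have ht00 : 0 < t0 := lt_of_le_of_ne ht0.1 (fun e => by rw [← e] at hft0; linarith)
    have ht01 : t0 < t1 := lt_of_le_of_ne ht0.2 (fun e => by rw [e] at hft0; linarith)
    have hdt0 : d t0 = 0 := by
      have : IsLocalMax f t0 := by
        filter_upwards [Ioo_mem_nhds ht00 ht01] with s hs
        exact hmax' s hs.1.le hs.2.le
      exact this.hasDerivAt_eq_zero (hf t0)
    have h3 : f t0 < 3 := by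
      by_contra h3
      push Not at h3
      rcases le_or_gt t0 τ with hc | hc
      · obtain ⟨a, ha1, ha2, ha3⟩ := ev_left (hfc.continuousAt.eventually_const_lt (show k < f t0 by linarith)) ht00
        have := left_pos (c := c) hf hdc hdt0.le ha2 (fun t ht => by
          refine ⟨f t - k * f (t - τ), (H1 t (by linarith [ht.2])).congr_deriv (by ring), ?_⟩
          have h5 := hle (t - τ) (by linarith [ht.2])
          have h6 := ha3 t ht.1 ht.2.le
          nlinarith)
        linarith [hmax' a ha1 (by linarith)]
      · have h4 := hgt (t0 - τ) (by linarith) (by linarith)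
        have hcc : Continuous fun t => f t + f (t - τ) := by fun_prop
        obtain ⟨a, ha1, ha2, ha3⟩ := ev_left
          (hcc.continuousAt.eventually_const_lt (show 4 < f t0 + f (t0 - τ) by linarith)) hc
        have := left_pos (c := c) hf hdc hdt0.le ha2 (fun t ht => by
          refine ⟨f t - (4 - f (t - τ)), (H2 t (by linarith [ht.1])
            (hgt _ (by linarith [ht.1]) (by linarith [ht.2]))).congr_deriv (by ring), ?_⟩
          have h6 := ha3 t ht.1 ht.2.le
          linarith)
        linarith [hmax' a (by linarith) (by linarith)]
    have hlt3 : ∀ s, 0 ≤ s → s ≤ t1 → f s < 3 := fun s h5 h6 => (hmax' s h5 h6).trans_lt h3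
    have hright : d t1 < 0 → ∃ δ > 0, ∀ t, t1 < t → t < t1 + δ → d t < 0 := by
      intro h
      obtain ⟨δ, hδ, h1⟩ := ev_right (hdc.continuousAt.eventually_lt_const h)
      exact ⟨δ, hδ, fun t h3 h4 => h1 t h3.le h4⟩
    rcases le_or_gt t1 τ with hc | hc
    · obtain ⟨δ, hδ, h5⟩ := hright (U t0 t1 ht01 hc hdt0.le)
      exact nr_stepA hf hdc hτ h2 H2 H3 ht10.le hft1 hgt hlt3 hδ h5
        (fun t h6 h7 => U t0 t (by linarith) h7 hdt0.le)
    · have hdt1 : d t1 < 0 := by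
        by_contra h4
        push Not at h4
        have hcc : Continuous fun t => f t + f (t - τ) := by fun_prop
        have h5 := hlt3 (t1 - τ) (by linarith) (by linarith)
        obtain ⟨a, ha1, ha2, ha3⟩ := ev_left
          (hcc.continuousAt.eventually_lt_const (show f t1 + f (t1 - τ) < 4 by linarith)) hc
        have := left_neg (c := c) (a := (a + t1) / 2) hf hdc h4 (by linarith) (fun t ht => by
          refine ⟨f t - (4 - f (t - τ)), (H2 t (by linarith [ht.1])
            (hgt _ (by linarith [ht.1]) (by linarith [ht.2]))).congr_deriv (by ring), ?_⟩
          have h6 := ha3 t (by linarith [ht.1]) ht.2.le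
          linarith)
        linarith [hgt ((a + t1) / 2) (by linarith) (by linarith)]
      obtain ⟨δ, hδ, h5⟩ := hright hdt1
      exact nr_stepA hf hdc hτ h2 H2 H3 ht10.le hft1 hgt hlt3 hδ h5 (fun t h6 h7 => by linarith)
end

lemma laplace {c τ μ t0 : ℝ} {f d Ψ : ℝ → ℝ} (hf : ∀ t, HasDerivAt f (d t) t) (hdc : Continuous d)
    (hτ : 0 ≤ τ) (hμ : 0 < μ) (hchi : μ ^ 2 - c * μ - 1 - Real.exp (-(μ * τ)) = 0)
    (h2 : Tendsto f atTop (nhds 2))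
    (hΨ : ∀ x, HasDerivAt Ψ ((f x - 2) * Real.exp (-(μ * x))) x)
    (heq : ∀ t, t0 + τ < t → HasDerivAt d (c * d t + f t - (4 - f (t - τ))) t) :
    ∀ t, t0 + τ ≤ t → d t + (μ - c) * (f t - 2) + Real.exp (μ * (t - τ)) * (Ψ t - Ψ (t - τ)) = 0 := by
  have hfc : Continuous f := continuous_iff_continuousAt.2 fun t => (hf t).continuousAt
  have hΨc : Continuous Ψ := continuous_iff_continuousAt.2 fun t => (hΨ t).continuousAt
  set J : ℝ → ℝ := fun t => d t + (μ - c) * (f t - 2) + Real.exp (μ * (t - τ)) * (Ψ t - Ψ (t - τ)) with hJ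
  have hJc : Continuous J := by simp only [hJ]; fun_prop
  have hJd : ∀ t, t0 + τ < t → HasDerivAt J (μ * J t) t := by
    intro t ht
    have e1 : HasDerivAt (fun t => Real.exp (μ * (t - τ))) (μ * Real.exp (μ * (t - τ))) t :=
      (hasDerivAt_exp_mul μ (t - τ)).comp_sub_const t τ
    have e2 : HasDerivAt (fun t => Ψ (t - τ)) ((f (t - τ) - 2) * Real.exp (-(μ * (t - τ)))) t :=
      (hΨ (t - τ)).comp_sub_const t τ
    refine (((heq t ht).add (((hf t).sub_const 2).const_mul (μ - c))).add
      (e1.mul ((hΨ t).sub e2))).congr_deriv ?_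
    have e3 : Real.exp (μ * (t - τ)) * Real.exp (-(μ * t)) = Real.exp (-(μ * τ)) := by
      rw [← Real.exp_add]; congr 1; ring
    have e4 : Real.exp (μ * (t - τ)) * Real.exp (-(μ * (t - τ))) = 1 := by
      rw [← Real.exp_add]; simp
    simp only [hJ, Pi.sub_apply]
    linear_combination (f t - 2) * e3 - (f (t - τ) - 2) * e4 - (f t - 2) * hchi
  have hconst : ∀ t s, t0 + τ ≤ t → t ≤ s → Real.exp (-μ * s) * J s = Real.exp (-μ * t) * J t := by
    intro t s ht hs
    have hcts : ContinuousOn (fun x => Real.exp (-μ * x) * J x) (Icc t s) := by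
      have : Continuous fun x => Real.exp (-μ * x) * J x := by fun_prop
      exact this.continuousOn
    have hd : ∀ x ∈ Ioo t s, HasDerivAt (fun x => Real.exp (-μ * x) * J x) 0 x := by
      intro x hx
      exact (hasDerivAt_exp_mul_fun (-μ) x (hJd x (ht.trans_lt hx.1))).congr_deriv (by ring)
    apply le_antisymm
    · exact anti_of_deriv (F := fun x => Real.exp (-μ * x) * J x) (F' := fun _ => 0) hs hcts hd (fun _ _ => le_rfl)
    · exact mono_of_deriv (F := fun x => Real.exp (-μ * x) * J x) (F' := fun _ => 0) hs hcts hd (fun _ _ => le_rfl)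
  intro t ht
  change J t = 0
  have hb : ∀ N, ∃ s ≥ N, |J s| ≤ 1 + |μ - c| + τ := by
    intro N
    have h1 : ∀ᶠ t in atTop, |f t - 2| < 1 := by
      have := (Metric.tendsto_nhds.1 h2) 1 (by norm_num)
      simpa [Real.dist_eq] using this
    obtain ⟨M, hM⟩ := eventually_atTop.1 h1
    obtain ⟨s, hs, hds⟩ := seq_atTop hf h2 one_pos (max N (M + τ))
    have hs1 := (le_max_left _ _).trans hs
    have hs2 := (le_max_right _ _).trans hs
    refine ⟨s, hs1, ?_⟩
    have h3 : ‖Ψ s - Ψ (s - τ)‖ ≤ Real.exp (-(μ * (s - τ))) * ‖s - (s - τ)‖ := by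
      apply (convex_Icc (s - τ) s).norm_image_sub_le_of_norm_hasDerivWithin_le
        (f' := fun x => (f x - 2) * Real.exp (-(μ * x)))
      · intro x hx; exact (hΨ x).hasDerivWithinAt
      · intro x hx
        rw [norm_mul, Real.norm_eq_abs, Real.norm_eq_abs, abs_of_pos (Real.exp_pos _)]
        have h4 := hM x (by linarith [hx.1])
        have h5 : Real.exp (-(μ * x)) ≤ Real.exp (-(μ * (s - τ))) := Real.exp_le_exp.2 (by nlinarith [hx.1])
        have := Real.exp_pos (-(μ * x))
        nlinarith [abs_nonneg (f x - 2)]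
      · exact ⟨le_rfl, by linarith⟩
      · exact ⟨by linarith, le_rfl⟩
    rw [Real.norm_eq_abs, Real.norm_eq_abs, show s - (s - τ) = τ by ring, abs_of_nonneg hτ] at h3
    have h6 : |Real.exp (μ * (s - τ)) * (Ψ s - Ψ (s - τ))| ≤ τ := by
      rw [abs_mul, abs_of_pos (Real.exp_pos _)]
      calc _ ≤ Real.exp (μ * (s - τ)) * (Real.exp (-(μ * (s - τ))) * τ) :=
            mul_le_mul_of_nonneg_left h3 (Real.exp_pos _).le
        _ = τ := by rw [← mul_assoc, ← Real.exp_add]; simp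
    have h7 : |(μ - c) * (f s - 2)| ≤ |μ - c| := by
      rw [abs_mul]
      have := hM s (by linarith)
      nlinarith [abs_nonneg (μ - c)]
    calc |J s| ≤ |d s| + |(μ - c) * (f s - 2)| + |Real.exp (μ * (s - τ)) * (Ψ s - Ψ (s - τ))| :=
          abs_add_three _ _ _
      _ ≤ _ := by linarith
  by_contra hne
  have hpos : 0 < |J t| := abs_pos.2 hne
  set C := 1 + |μ - c| + τ with hC
  have h3 : Tendsto (fun s : ℝ => Real.exp (-(μ * (s - t))) * C) atTop (nhds 0) := by
    have : Tendsto (fun s : ℝ => μ * (s - t)) atTop atTop :=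
      (tendsto_atTop_add_const_right _ (-t) tendsto_id).const_mul_atTop hμ
    have := (Real.tendsto_exp_neg_atTop_nhds_zero.comp this).mul_const C
    simpa using this
  obtain ⟨N, hN⟩ := eventually_atTop.1 (h3.eventually_lt_const hpos)
  obtain ⟨s, hs, hJs⟩ := hb (max N t)
  have h4 := hN s ((le_max_left _ _).trans hs)
  have h5 := hconst t s ht ((le_max_right _ _).trans hs)
  have h6 : J t = Real.exp (-(μ * (s - t))) * J s := by
    have e1 : Real.exp (-(μ * (s - t))) = Real.exp (μ * t) * Real.exp (-μ * s) := by
      rw [← Real.exp_add]; congr 1; ring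
    have e2 : Real.exp (μ * t) * Real.exp (-μ * t) = 1 := by
      rw [← Real.exp_add]; simp
    rw [e1, mul_assoc, h5, ← mul_assoc, e2, one_mul]
  have h7 : |J t| ≤ Real.exp (-(μ * (s - t))) * C := by
    rw [h6, abs_mul, abs_of_pos (Real.exp_pos _)]
    exact mul_le_mul_of_nonneg_left hJs (Real.exp_pos _).le
  linarith

lemma exists_primitive {g : ℝ → ℝ} (hg : Continuous g) : ∃ P : ℝ → ℝ, ∀ x, HasDerivAt P (g x) x :=
  ⟨fun x => ∫ r in (0:ℝ)..x, g r, fun x =>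
    intervalIntegral.integral_hasDerivAt_right (hg.intervalIntegrable _ _)
      (hg.stronglyMeasurableAtFilter _ _) hg.continuousAt⟩

/-- normalization of a wavefront -/
lemma front_normalize {k c h : ℝ} {φ : ℝ → ℝ} (H : ToyWavefront k c h φ) :
    ∃ f d : ℝ → ℝ, (∀ t, HasDerivAt f (d t) t) ∧ Continuous d ∧ (∀ t, 0 < f t) ∧
      Tendsto f atBot (nhds 0) ∧ Tendsto f atTop (nhds 2) ∧ f 0 = 1 ∧ (∀ t < 0, f t < 1) ∧
      ∀ t, f (t - c * h) ≠ 1 → HasDerivAt d (c * d t + f t - gtoy k (f (t - c * h))) t := by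
  obtain ⟨hC, hpos, h0, h2, heq⟩ := H
  have hd : ∀ t, HasDerivAt φ (deriv φ t) t := fun t =>
    ((hC.differentiable (by norm_num)) t).hasDerivAt
  have hfc : Continuous φ := hC.continuous
  have hdc : Continuous (deriv φ) := hC.continuous_deriv (by norm_num)
  obtain ⟨N, hN⟩ := eventually_atBot.1 (h0.eventually_lt_const one_pos)
  obtain ⟨M, hM⟩ := (h2.eventually_const_lt (by norm_num : (1:ℝ) < 2)).exists
  have hNM : N ≤ M := by
    by_contra hcon
    push Not at hcon
    linarith [hN M hcon.le]
  have hcl : IsClosed {s | 1 ≤ φ s} := isClosed_le continuous_const hfc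
  obtain ⟨p, ⟨hp, hp1⟩, hmin⟩ := (isCompact_Icc.inter_right hcl).exists_isLeast
    (⟨M, ⟨hNM, le_rfl⟩, hM.le⟩ : (Icc N M ∩ {s | 1 ≤ φ s}).Nonempty)
  have hp1 : 1 ≤ φ p := hp1
  have hlt : ∀ t < p, φ t < 1 := by
    intro t ht
    rcases le_or_gt t N with h | h
    · exact hN t h
    · by_contra h3
      push Not at h3
      have := hmin ⟨⟨h.le, ht.le.trans hp.2⟩, h3⟩
      linarith
  have hpe : φ p = 1 := by
    refine le_antisymm ?_ hp1
    by_contra h3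
    push Not at h3
    obtain ⟨a, _, ha2, ha3⟩ := ev_left (b := p - 1) (hfc.continuousAt.eventually_const_lt h3) (by linarith)
    linarith [ha3 ((a + p) / 2) (by linarith) (by linarith), hlt ((a + p) / 2) (by linarith)]
  refine ⟨fun t => φ (t + p), fun t => deriv φ (t + p), fun t => (hd _).comp_add_const t p,
    by fun_prop, fun t => hpos _, h0.comp (tendsto_atBot_add_const_right _ _ tendsto_id),
    h2.comp (tendsto_atTop_add_const_right _ _ tendsto_id), by simpa using hpe,
    fun t ht => hlt _ (by linarith), ?_⟩
  intro t ht
  have e : t - c * h + p = t + p - c * h := by ring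
  simp only [e] at ht ⊢
  exact (heq (t + p) ht).comp_add_const t p

/-- after the first crossing, a wavefront stays above 1 -/
lemma cross {k c τ μ : ℝ} {f d : ℝ → ℝ} (hf : ∀ t, HasDerivAt f (d t) t) (hdc : Continuous d) (hτ : 0 ≤ τ)
    (hk1 : 1 < k) (hk3 : k < 3) (f0 : f 0 = 1) (hlt : ∀ t < 0, f t < 1) (hpos : ∀ t, 0 < f t)
    (U : ∀ a t, a < t → t ≤ τ → d a ≤ 0 → d t < 0)
    (h2 : Tendsto f atTop (nhds 2))
    (hμ : 0 < μ) (hμc : 0 < μ - c) (hchi : μ ^ 2 - c * μ - 1 - Real.exp (-(μ * τ)) = 0)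
    (heq : ∀ t, f (t - τ) ≠ 1 → HasDerivAt d (c * d t + f t - gtoy k (f (t - τ))) t) :
    ∀ t > 0, 1 < f t := by
  have hfc : Continuous f := continuous_iff_continuousAt.2 fun t => (hf t).continuousAt
  have hle : ∀ t ≤ 0, f t ≤ 1 := by
    intro t ht
    rcases ht.lt_or_eq with h | h
    · exact (hlt t h).le
    · rw [h, f0]
  have heq1 : ∀ t, f (t - τ) < 1 → HasDerivAt d (c * d t + f t - k * f (t - τ)) t := by
    intro t ht
    have := heq t ht.ne
    rwa [gtoy, if_pos ht] at this
  have heq2 : ∀ t, 1 < f (t - τ) → HasDerivAt d (c * d t + f t - (4 - f (t - τ))) t := by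
    intro t ht
    have := heq t ht.ne'
    rwa [gtoy, if_neg (not_lt.2 ht.le)] at this
  rcases hτ.lt_or_eq with hτ0 | hτ0
  · refine no_return (c := c) hf hdc hτ hk1 hk3 f0 hle U h2 (Or.inr hτ0)
      (fun t ht => heq1 t (hlt _ (by linarith))) (fun t _ h => heq2 t h) (fun t _ h => ⟨_, heq1 t h, fun h3 => ?_⟩)
    have := hpos (t - τ)
    nlinarith
  · obtain ⟨M, hM⟩ := eventually_atTop.1 (h2.eventually_const_lt (by norm_num : (1:ℝ) < 2))
    have hM0 : 0 ≤ M := by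
      by_contra hcon
      push Not at hcon
      linarith [hM 0 hcon.le]
    have hcl : IsClosed {s | f s ≤ 1} := isClosed_le hfc continuous_const
    obtain ⟨b, ⟨hb, hb1⟩, hmax⟩ := (isCompact_Icc.inter_right hcl).exists_isGreatest
      (⟨0, ⟨le_rfl, hM0⟩, f0.le⟩ : (Icc 0 M ∩ {s | f s ≤ 1}).Nonempty)
    have hb1 : f b ≤ 1 := hb1
    have hgt : ∀ t > b, 1 < f t := by
      intro t ht
      rcases le_total M t with h | h
      · exact hM t h
      · by_contra h3
        push Not at h3
        have := hmax ⟨⟨by linarith [hb.1], h⟩, h3⟩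
        linarith
    have hbe : f b = 1 := by
      refine le_antisymm hb1 ?_
      by_contra h3
      push Not at h3
      obtain ⟨δ, hδ, h4⟩ := ev_right (hfc.continuousAt.eventually_lt_const h3)
      linarith [h4 (b + δ / 2) (by linarith) (by linarith), hgt (b + δ / 2) (by linarith)]
    obtain ⟨Ψ, hΨ⟩ := exists_primitive (g := fun x => (f x - 2) * Real.exp (-(μ * x))) (by fun_prop)
    have hL := laplace (t0 := b) hf hdc hτ hμ hchi h2 hΨ (fun t ht => heq2 t (hgt _ (by linarith))) b (by linarith)
    rw [← hτ0, sub_zero, sub_self, hbe] at hL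
    have hdb : 0 < d b := by linarith
    rcases hb.1.lt_or_eq with hb0 | hb0
    · exfalso
      obtain ⟨b', hb'0, hb'b, hb'd⟩ := ev_left (hdc.continuousAt.eventually_const_lt hdb) hb0
      have hb'1 : ∀ t, b' ≤ t → t < b → f t < 1 := by
        intro t h1 h2
        rw [← hbe]
        exact smono_of_deriv h2 hfc.continuousOn (fun x _ => hf x)
          (fun x hx => hb'd x (by linarith [hx.1]) hx.2.le)
      have hcl : IsClosed {s | 1 ≤ f s} := isClosed_le continuous_const hfc
      obtain ⟨a, ⟨ha, ha1⟩, hamax⟩ := (isCompact_Icc.inter_right hcl).exists_isGreatest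
        (⟨0, ⟨le_rfl, hb'0⟩, f0.ge⟩ : (Icc 0 b' ∩ {s | 1 ≤ f s}).Nonempty)
      have ha1 : 1 ≤ f a := ha1
      have hab : a < b := ha.2.trans_lt hb'b
      have hin : ∀ t, a < t → t < b → f t < 1 := by
        intro t h1 h2
        rcases le_total b' t with h | h
        · exact hb'1 t h h2
        · by_contra h3
          push Not at h3
          have := hamax ⟨⟨by linarith [ha.1], h⟩, h3⟩
          linarith
      obtain ⟨tm, htm, hmin⟩ := isCompact_Icc.exists_isMinOn (nonempty_Icc.2 hab.le) hfc.continuousOn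
      have hmin' : ∀ s, a ≤ s → s ≤ b → f tm ≤ f s := fun s h1 h2 => hmin ⟨h1, h2⟩
      have hf1 : f tm < 1 := (hmin' ((a + b) / 2) (by linarith) (by linarith)).trans_lt
        (hin _ (by linarith) (by linarith))
      have h1 : a < tm := lt_of_le_of_ne htm.1 (fun e => by rw [← e] at hf1; linarith)
      have h3 : tm < b := lt_of_le_of_ne htm.2 (fun e => by rw [e] at hf1; linarith)
      have hdt : d tm = 0 := by
        have : IsLocalMin f tm := by
          filter_upwards [Ioo_mem_nhds h1 h3] with s hs
          exact hmin' s hs.1.le hs.2.le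
        exact this.hasDerivAt_eq_zero (hf tm)
      have := left_neg (c := c) hf hdc hdt.ge h1 (fun t ht => by
        have h5 := hin t ht.1 (ht.2.trans h3)
        have h6 := heq1 t (by rwa [← hτ0, sub_zero])
        rw [← hτ0, sub_zero] at h6
        refine ⟨f t - k * f t, h6.congr_deriv (by ring), ?_⟩
        have := hpos t
        nlinarith)
      linarith
    · rw [← hb0] at hgt; exact hgt

/-- necessary condition on the ratio -/
lemma front_ratio {k c τ μ l : ℝ} {f d : ℝ → ℝ} (hf : ∀ t, HasDerivAt f (d t) t) (hdc : Continuous d)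
    (hτ : 0 ≤ τ) (f0 : f 0 = 1) (hgt : ∀ t > 0, 1 < f t)
    (h2 : Tendsto f atTop (nhds 2))
    (hl0 : 0 < l) (hlμ : l < μ) (hμc : 0 < μ - c) (hchi : μ ^ 2 - c * μ - 1 - Real.exp (-(μ * τ)) = 0)
    (hl : l ^ 2 - c * l - 1 + k * Real.exp (-(l * τ)) = 0)
    (hdl : ∀ t ≤ τ, d t ≤ l * f t)
    (heq : ∀ t, f (t - τ) ≠ 1 → HasDerivAt d (c * d t + f t - gtoy k (f (t - τ))) t) :
    (3 - k) / 4 * μ ≤ l := by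
  have hfc : Continuous f := continuous_iff_continuousAt.2 fun t => (hf t).continuousAt
  have hμ : 0 < μ := hl0.trans hlμ
  have heq2 : ∀ t, 1 < f (t - τ) → HasDerivAt d (c * d t + f t - (4 - f (t - τ))) t := by
    intro t ht
    have := heq t ht.ne'
    rwa [gtoy, if_neg (not_lt.2 ht.le)] at this
  obtain ⟨Ψ, hΨ⟩ := exists_primitive (g := fun x => (f x - 2) * Real.exp (-(μ * x))) (by fun_prop)
  have hL := laplace (t0 := 0) hf hdc hτ hμ hchi h2 hΨ (fun t ht => heq2 t (hgt _ (by linarith))) τ (by linarith)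
  rw [sub_self, mul_zero, Real.exp_zero, one_mul] at hL
  have hfe : ∀ t, 0 ≤ t → t ≤ τ → f t ≤ Real.exp (l * t) := by
    intro t h0 ht
    have h1 := anti_of_deriv (F := fun x => Real.exp (-l * x) * f x)
      (F' := fun x => Real.exp (-l * x) * (d x + -l * f x)) h0
      (by have : Continuous fun x => Real.exp (-l * x) * f x := by fun_prop
          exact this.continuousOn)
      (fun x hx => hasDerivAt_exp_mul_fun (-l) x (hf x))
      (fun x hx => mul_nonpos_of_nonneg_of_nonpos (Real.exp_pos _).le (by linarith [hdl x (by linarith [hx.2])]))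
    simp only [mul_zero, Real.exp_zero, f0, one_mul] at h1
    have h3 := mul_le_mul_of_nonneg_left h1 (Real.exp_pos (l * t)).le
    rw [← mul_assoc, ← Real.exp_add] at h3
    simpa using h3
  have hΨle := anti_of_deriv (F := fun x => Ψ x - (l - μ)⁻¹ * Real.exp ((l - μ) * x) - 2 * μ⁻¹ * Real.exp (-μ * x))
    (F' := fun x => (f x - Real.exp (l * x)) * Real.exp (-(μ * x))) hτ
    (by have hΨc : Continuous Ψ := continuous_iff_continuousAt.2 fun t => (hΨ t).continuousAt
        have : Continuous fun x => Ψ x - (l - μ)⁻¹ * Real.exp ((l - μ) * x) - 2 * μ⁻¹ * Real.exp (-μ * x) := by fun_prop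
        exact this.continuousOn)
    (fun x hx => by
      refine (((hΨ x).sub ((hasDerivAt_exp_mul (l - μ) x).const_mul (l - μ)⁻¹)).sub
        ((hasDerivAt_exp_mul (-μ) x).const_mul (2 * μ⁻¹))).congr_deriv ?_
      have e1 : Real.exp ((l - μ) * x) = Real.exp (l * x) * Real.exp (-(μ * x)) := by
        rw [← Real.exp_add]; congr 1; ring
      have e2 : -μ * x = -(μ * x) := by ring
      have : l - μ ≠ 0 := by linarith
      rw [e1, e2]; field_simp; ring)
    (fun x hx => mul_nonpos_of_nonpos_of_nonneg (by linarith [hfe x hx.1.le hx.2.le]) (Real.exp_pos _).le)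
  have e1 : Real.exp ((l - μ) * τ) = Real.exp (l * τ) * Real.exp (-(μ * τ)) := by
    rw [← Real.exp_add]; congr 1; ring
  have e3 : -μ * τ = -(μ * τ) := by ring
  simp only [mul_zero, Real.exp_zero, e1, e3] at hΨle
  have h4 := hfe τ hτ le_rfl
  have h5 := hdl τ le_rfl
  set E := Real.exp (l * τ) with hE
  set X := Real.exp (-(μ * τ)) with hX
  have hEl : E * Real.exp (-(l * τ)) = 1 := by rw [hE, ← Real.exp_add]; simp
  have h6 : (l + μ - c) * f τ ≤ (l + μ - c) * E := mul_le_mul_of_nonneg_left h4 (by linarith)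
  have h7 : 0 ≤ (l + μ - c) * E - 2 * (μ - c) + (l - μ)⁻¹ * (E * X) + 2 * μ⁻¹ * X - (l - μ)⁻¹ - 2 * μ⁻¹ := by
    nlinarith
  have hne : l - μ ≠ 0 := by linarith
  have h8 : (l + μ - c) * E - 2 * (μ - c) + (l - μ)⁻¹ * (E * X) + 2 * μ⁻¹ * X - (l - μ)⁻¹ - 2 * μ⁻¹
      = (k + 1) * (μ - l)⁻¹ - 4 * μ⁻¹ := by
    have hne2 : μ - l ≠ 0 := by linarith
    have e5 : (μ - l)⁻¹ = - (l - μ)⁻¹ := by rw [← inv_neg]; congr 1; ring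
    have e6 : (l - μ) * (l - μ)⁻¹ = 1 := mul_inv_cancel₀ hne
    have e7 : μ * μ⁻¹ = 1 := mul_inv_cancel₀ hμ.ne'
    rw [e5]
    have h9 : E * ((l - μ) * (l + μ - c) + X) = - k := by
      linear_combination E * hl - E * hchi - k * hEl
    have h10 : μ * (μ - c) = 1 + X := by linear_combination hchi
    linear_combination (l - μ)⁻¹ * h9 - 2 * μ⁻¹ * h10 - (l + μ - c) * E * e6 + 2 * (μ - c) * e7
  rw [h8] at h7
  have h9 : 4 * μ⁻¹ ≤ (k + 1) * (μ - l)⁻¹ := by linarith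
  rw [← div_eq_mul_inv, ← div_eq_mul_inv, div_le_div_iff₀ hμ (by linarith)] at h9
  linarith

/-- the weighted delayed integral -/
def Iop (μ τ : ℝ) (ψ : ℝ → ℝ) (t : ℝ) : ℝ :=
  Real.exp (μ * (t - τ)) * ∫ r in (t - τ)..t, ψ r * Real.exp (-(μ * r))

lemma Iop_eq {μ τ : ℝ} {ψ P : ℝ → ℝ} (hψ : Continuous ψ)
    (hP : ∀ x, HasDerivAt P (ψ x * Real.exp (-(μ * x))) x) (t : ℝ) :
    Iop μ τ ψ t = Real.exp (μ * (t - τ)) * (P t - P (t - τ)) := by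
  unfold Iop
  congr 1
  refine intervalIntegral.integral_eq_sub_of_hasDerivAt (fun x _ => hP x) ?_
  have : Continuous fun x => ψ x * Real.exp (-(μ * x)) := by fun_prop
  exact this.intervalIntegrable _ _

lemma Iop_deriv {μ τ : ℝ} {ψ : ℝ → ℝ} (hψ : Continuous ψ) (t : ℝ) :
    HasDerivAt (Iop μ τ ψ) (μ * Iop μ τ ψ t + ψ t * Real.exp (-(μ * τ)) - ψ (t - τ)) t := by
  obtain ⟨P, hP⟩ := exists_primitive (g := fun x => ψ x * Real.exp (-(μ * x))) (by fun_prop)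
  have h1 : Iop μ τ ψ = fun t => Real.exp (μ * (t - τ)) * (P t - P (t - τ)) := funext (Iop_eq hψ hP)
  rw [h1]
  have e1 : HasDerivAt (fun t => Real.exp (μ * (t - τ))) (μ * Real.exp (μ * (t - τ))) t :=
    (hasDerivAt_exp_mul μ (t - τ)).comp_sub_const t τ
  have e2 : HasDerivAt (fun t => P (t - τ)) (ψ (t - τ) * Real.exp (-(μ * (t - τ)))) t :=
    (hP (t - τ)).comp_sub_const t τ
  refine (e1.mul ((hP t).sub e2)).congr_deriv ?_
  have e3 : Real.exp (μ * (t - τ)) * Real.exp (-(μ * t)) = Real.exp (-(μ * τ)) := by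
    rw [← Real.exp_add]; congr 1; ring
  have e4 : Real.exp (μ * (t - τ)) * Real.exp (-(μ * (t - τ))) = 1 := by
    rw [← Real.exp_add]; simp
  simp only [Pi.sub_apply]
  linear_combination ψ t * e3 - ψ (t - τ) * e4

lemma Iop_cont {μ τ : ℝ} {ψ : ℝ → ℝ} (hψ : Continuous ψ) : Continuous (Iop μ τ ψ) :=
  continuous_iff_continuousAt.2 fun t => (Iop_deriv hψ t).continuousAt

lemma Iop_sub {μ τ : ℝ} {ψ χ : ℝ → ℝ} (hψ : Continuous ψ) (hχ : Continuous χ) (t : ℝ) :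
    Iop μ τ (fun x => ψ x - χ x) t = Iop μ τ ψ t - Iop μ τ χ t := by
  unfold Iop
  rw [← mul_sub, ← intervalIntegral.integral_sub]
  · simp only [sub_mul]
  · have : Continuous fun x => ψ x * Real.exp (-(μ * x)) := by fun_prop
    exact this.intervalIntegrable _ _
  · have : Continuous fun x => χ x * Real.exp (-(μ * x)) := by fun_prop
    exact this.intervalIntegrable _ _

lemma Iop_neg {μ τ : ℝ} {ψ : ℝ → ℝ} (t : ℝ) :
    Iop μ τ (fun x => - ψ x) t = - Iop μ τ ψ t := by
  unfold Iop
  simp [neg_mul, intervalIntegral.integral_neg]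

lemma Iop_le {μ τ b : ℝ} {ψ : ℝ → ℝ} (hμ : 0 < μ) (hτ : 0 ≤ τ) (hψ : Continuous ψ) (t : ℝ)
    (hb : ∀ r, t - τ ≤ r → r ≤ t → ψ r ≤ b) :
    Iop μ τ ψ t ≤ b * ((1 - Real.exp (-(μ * τ))) / μ) := by
  obtain ⟨P, hP⟩ := exists_primitive (g := fun x => ψ x * Real.exp (-(μ * x))) (by fun_prop)
  rw [Iop_eq hψ hP]
  have hPc : Continuous P := continuous_iff_continuousAt.2 fun t => (hP t).continuousAt
  have h1 := anti_of_deriv (F := fun x => P x + b / μ * Real.exp (-μ * x))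
    (F' := fun x => (ψ x - b) * Real.exp (-(μ * x))) (by linarith : t - τ ≤ t)
    (by have : Continuous fun x => P x + b / μ * Real.exp (-μ * x) := by fun_prop
        exact this.continuousOn)
    (fun x _ => by
      refine ((hP x).add ((hasDerivAt_exp_mul (-μ) x).const_mul (b / μ))).congr_deriv ?_
      have e2 : -μ * x = -(μ * x) := by ring
      rw [e2]; field_simp; ring)
    (fun x hx => mul_nonpos_of_nonpos_of_nonneg (by linarith [hb x hx.1.le hx.2.le]) (Real.exp_pos _).le)
  have e3 : Real.exp (μ * (t - τ)) * Real.exp (-μ * t) = Real.exp (-(μ * τ)) := by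
    rw [← Real.exp_add]; congr 1; ring
  have e4 : Real.exp (μ * (t - τ)) * Real.exp (-μ * (t - τ)) = 1 := by
    rw [← Real.exp_add]; simp
  have h2 : P t - P (t - τ) ≤ b / μ * Real.exp (-μ * (t - τ)) - b / μ * Real.exp (-μ * t) := by
    linarith
  have h3 := mul_le_mul_of_nonneg_left h2 (Real.exp_pos (μ * (t - τ))).le
  refine h3.trans (le_of_eq ?_)
  linear_combination b / μ * e4 - b / μ * e3

lemma Iop_abs {μ τ b : ℝ} {ψ : ℝ → ℝ} (hμ : 0 < μ) (hτ : 0 ≤ τ) (hψ : Continuous ψ) (t : ℝ)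
    (hb : ∀ r, t - τ ≤ r → r ≤ t → |ψ r| ≤ b) :
    |Iop μ τ ψ t| ≤ b * ((1 - Real.exp (-(μ * τ))) / μ) := by
  have h1 := Iop_le hμ hτ hψ t (fun r h1 h2 => (abs_le.1 (hb r h1 h2)).2)
  have h2 := Iop_le hμ hτ hψ.neg t (b := b) (fun r h1 h2 => by
    have := (abs_le.1 (hb r h1 h2)).1
    simp only [Pi.neg_apply]; linarith)
  have h3 : Iop μ τ (-ψ) t = - Iop μ τ ψ t := Iop_neg t
  rw [h3] at h2
  rw [abs_le]; constructor <;> linarith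

lemma Y_abs {α τ b s : ℝ} {g : ℝ → ℝ} (hα : 0 < α) (hg : Continuous g) (hs : τ ≤ s) (hb0 : 0 ≤ b)
    (hb : ∀ u, |g u| ≤ b) :
    |Real.exp (-α * s) * ∫ u in τ..s, Real.exp (α * u) * g u| ≤ b / α := by
  have h1 : ‖∫ u in τ..s, Real.exp (α * u) * g u‖ ≤ ∫ u in τ..s, b * Real.exp (α * u) := by
    apply intervalIntegral.norm_integral_le_of_norm_le hs
    · refine Eventually.of_forall fun u _ => ?_
      rw [norm_mul, Real.norm_eq_abs, Real.norm_eq_abs, abs_of_pos (Real.exp_pos _), mul_comm]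
      exact mul_le_mul_of_nonneg_right (hb u) (Real.exp_pos _).le
    · have : Continuous fun u => b * Real.exp (α * u) := by fun_prop
      exact this.intervalIntegrable _ _
  have h2 : ∫ u in τ..s, b * Real.exp (α * u) = b / α * Real.exp (α * s) - b / α * Real.exp (α * τ) := by
    refine intervalIntegral.integral_eq_sub_of_hasDerivAt (f := fun u => b / α * Real.exp (α * u)) (fun x _ => ?_) ?_
    · exact ((hasDerivAt_exp_mul α x).const_mul (b / α)).congr_deriv (by field_simp)
    · have : Continuous fun u => b * Real.exp (α * u) := by fun_prop
      exact this.intervalIntegrable _ _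
  rw [h2, Real.norm_eq_abs] at h1
  rw [abs_mul, abs_of_pos (Real.exp_pos _)]
  have h3 := mul_le_mul_of_nonneg_left h1 (Real.exp_pos (-α * s)).le
  have e4 : Real.exp (-α * s) * Real.exp (α * s) = 1 := by
    rw [← Real.exp_add]; simp
  have h5 : 0 ≤ Real.exp (-α * s) * (b / α * Real.exp (α * τ)) := by positivity
  calc _ ≤ _ := h3
    _ = b / α * (Real.exp (-α * s) * Real.exp (α * s)) - Real.exp (-α * s) * (b / α * Real.exp (α * τ)) := by ring
    _ ≤ _ := by rw [e4]; linarith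

lemma right_solve {α μ τ B : ℝ} {q : ℝ → ℝ} (hμ : 0 < μ) (hτ : 0 ≤ τ)
    (hα : α * μ = 1 + Real.exp (-(μ * τ))) (hq : Continuous q) (hqB : ∀ t, |q t| ≤ B) :
    ∃ ψ R : ℝ → ℝ, Continuous ψ ∧ (∃ C, ∀ t, |ψ t| ≤ C) ∧ (∀ t ≤ τ, ψ t = q t) ∧
      (∀ t, τ ≤ t → ψ t = R t) ∧ ∀ t, HasDerivAt R (-α * R t - Iop μ τ ψ t) t := by
  have hX := Real.exp_pos (-(μ * τ))
  have hX1 : Real.exp (-(μ * τ)) ≤ 1 := Real.exp_le_one_iff.2 (by have := mul_nonneg hμ.le hτ; linarith)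
  have hα0 : 0 < α := by
    by_contra h
    push Not at h
    nlinarith
  set β := (1 - Real.exp (-(μ * τ))) / μ with hβ
  have hβ0 : 0 ≤ β := div_nonneg (by linarith) hμ.le
  have hβα : β < α := by rw [hβ, div_lt_iff₀ hμ]; linarith
  have hB0 : 0 ≤ B := (abs_nonneg _).trans (hqB 0)
  -- the formula
  set Y : (ℝ → ℝ) → ℝ → ℝ := fun ψ s => Real.exp (-α * s) * ∫ u in τ..s, Real.exp (α * u) * Iop μ τ ψ u with hY
  have hYd : ∀ ψ, Continuous ψ → ∀ s, HasDerivAt (Y ψ) (-α * Y ψ s + Iop μ τ ψ s) s := by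
    intro ψ hψ s
    have hc := Iop_cont (μ := μ) (τ := τ) hψ
    have hc2 : Continuous fun u => Real.exp (α * u) * Iop μ τ ψ u := by fun_prop
    have h1 : HasDerivAt (fun s => ∫ u in τ..s, Real.exp (α * u) * Iop μ τ ψ u)
        (Real.exp (α * s) * Iop μ τ ψ s) s :=
      intervalIntegral.integral_hasDerivAt_right (hc2.intervalIntegrable _ _)
        (hc2.stronglyMeasurableAtFilter _ _) hc2.continuousAt
    refine (hasDerivAt_exp_mul_fun (-α) s h1).congr_deriv ?_
    have e4 : Real.exp (-α * s) * Real.exp (α * s) = 1 := by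
      rw [← Real.exp_add]; simp
    simp only [hY]
    linear_combination Iop μ τ ψ s * e4
  have hYc : ∀ ψ, Continuous ψ → Continuous (Y ψ) := fun ψ hψ =>
    continuous_iff_continuousAt.2 fun t => (hYd ψ hψ t).continuousAt
  have hYb : ∀ ψ, Continuous ψ → ∀ b, 0 ≤ b → (∀ t, |ψ t| ≤ b) → ∀ s, τ ≤ s → |Y ψ s| ≤ b * β / α := by
    intro ψ hψ b hb0 hb s hs
    exact Y_abs hα0 (Iop_cont hψ) hs (mul_nonneg hb0 hβ0) (fun u => Iop_abs hμ hτ hψ u (fun r _ _ => hb r))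
  have hYs : ∀ ψ χ, Continuous ψ → Continuous χ → ∀ s, Y (fun x => ψ x - χ x) s = Y ψ s - Y χ s := by
    intro ψ χ hψ hχ s
    have hc := Iop_cont (μ := μ) (τ := τ) hψ
    have hc' := Iop_cont (μ := μ) (τ := τ) hχ
    have i1 : Continuous fun u => Real.exp (α * u) * Iop μ τ ψ u := by fun_prop
    have i2 : Continuous fun u => Real.exp (α * u) * Iop μ τ χ u := by fun_prop
    simp only [hY]
    rw [← mul_sub, ← intervalIntegral.integral_sub (i1.intervalIntegrable _ _) (i2.intervalIntegrable _ _)]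
    simp only [Iop_sub hψ hχ, mul_sub]
  set G : (ℝ → ℝ) → ℝ → ℝ := fun ψ t =>
    Real.exp (-α * (max t τ - τ)) * q (min t τ) - Y ψ (max t τ) with hG
  have hGc : ∀ ψ, Continuous ψ → Continuous (G ψ) := by
    intro ψ hψ
    have := hYc ψ hψ
    simp only [hG]
    fun_prop
  have hGb : ∀ ψ, Continuous ψ → ∀ b, 0 ≤ b → (∀ t, |ψ t| ≤ b) → ∀ t, ‖G ψ t‖ ≤ B + b * β / α := by
    intro ψ hψ b hb0 hb t
    have h1 := hYb ψ hψ b hb0 hb (max t τ) (le_max_right _ _)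
    have h2 : |Real.exp (-α * (max t τ - τ)) * q (min t τ)| ≤ B := by
      rw [abs_mul, abs_of_pos (Real.exp_pos _)]
      have h3 : Real.exp (-α * (max t τ - τ)) ≤ 1 := Real.exp_le_one_iff.2 (by
        have := le_max_right t τ
        nlinarith)
      have h4 := hqB (min t τ)
      have h5 := Real.exp_pos (-α * (max t τ - τ))
      have := abs_nonneg (q (min t τ))
      nlinarith
    calc ‖G ψ t‖ ≤ |Real.exp (-α * (max t τ - τ)) * q (min t τ)| + |Y ψ (max t τ)| := abs_sub _ _
      _ ≤ _ := by linarith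
  let TT : BoundedContinuousFunction ℝ ℝ → BoundedContinuousFunction ℝ ℝ := fun ψ =>
    BoundedContinuousFunction.ofNormedAddCommGroup (G ψ) (hGc ψ ψ.continuous) (B + ‖ψ‖ * β / α)
      (hGb ψ ψ.continuous ‖ψ‖ (norm_nonneg _) (fun t => ψ.norm_coe_le_norm t))
  have hcontr : ContractingWith ⟨β / α, div_nonneg hβ0 hα0.le⟩ TT := by
    refine ⟨?_, ?_⟩
    · exact NNReal.coe_lt_coe.1 (show β / α < 1 from (div_lt_one hα0).2 hβα)
    · apply LipschitzWith.of_dist_le_mul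
      intro x y
      change _ ≤ β / α * dist x y
      rw [BoundedContinuousFunction.dist_le (mul_nonneg (div_nonneg hβ0 hα0.le) dist_nonneg)]
      intro t
      change dist (G x t) (G y t) ≤ _
      have h1 := hYb (fun u => x u - y u) (x.continuous.sub y.continuous) (dist x y) dist_nonneg (fun u => by
        have := BoundedContinuousFunction.dist_coe_le_dist (f := x) (g := y) u
        rwa [Real.dist_eq] at this) (max t τ) (le_max_right _ _)
      rw [hYs x y x.continuous y.continuous] at h1
      rw [Real.dist_eq]
      simp only [hG]
      rw [show Real.exp (-α * (max t τ - τ)) * q (min t τ) - Y x (max t τ)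
        - (Real.exp (-α * (max t τ - τ)) * q (min t τ) - Y y (max t τ)) = -(Y x (max t τ) - Y y (max t τ)) by ring,
        abs_neg]
      refine h1.trans (le_of_eq (by ring))
  set ψ := ContractingWith.fixedPoint TT hcontr with hψ
  have hfix : TT ψ = ψ := hcontr.fixedPoint_isFixedPt
  have hfix' : ∀ t, ψ t = G ψ t := by
    intro t
    conv_lhs => rw [← hfix]
    rfl
  refine ⟨ψ, fun t => Real.exp (-α * (t - τ)) * q τ - Y ψ t, ψ.continuous, ⟨‖ψ‖, fun t => ψ.norm_coe_le_norm t⟩,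
    ?_, ?_, ?_⟩
  · intro t ht
    rw [hfix' t]
    simp [hG, hY, max_eq_right ht, min_eq_left ht]
  · intro t ht
    rw [hfix' t]
    simp only [hG, max_eq_left ht, min_eq_right ht]
  · intro t
    have e1 : HasDerivAt (fun t => Real.exp (-α * (t - τ))) (-α * Real.exp (-α * (t - τ))) t :=
      (hasDerivAt_exp_mul (-α) (t - τ)).comp_sub_const t τ
    exact ((e1.mul_const (q τ)).sub (hYd ψ ψ.continuous t)).congr_deriv (by ring)

lemma decay_half {α μ τ b T : ℝ} {ψ : ℝ → ℝ} (hμ : 0 < μ) (hτ : 0 ≤ τ) (hα0 : 0 < α) (hψ : Continuous ψ)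
    (hT : 0 ≤ T) (hd : ∀ t, τ < t → HasDerivAt ψ (-α * ψ t - Iop μ τ ψ t) t)
    {θ : ℝ} (hθ0 : 0 ≤ θ) (hθ : α * θ = (1 - Real.exp (-(μ * τ))) / μ) (hb0 : 0 ≤ b)
    (hb : ∀ t, T ≤ t → |ψ t| ≤ b) :
    ∀ t, T + τ ≤ t → ψ t ≤ θ * b + Real.exp (-α * (t - (T + τ))) * b := by
  intro t ht
  have h1 := anti_of_deriv (F := fun x => Real.exp (α * x) * (ψ x - θ * b))
    (F' := fun x => Real.exp (α * x) * ((-α * ψ x - Iop μ τ ψ x) + α * (ψ x - θ * b))) ht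
    (by have : Continuous fun x => Real.exp (α * x) * (ψ x - θ * b) := by fun_prop
        exact this.continuousOn)
    (fun x hx => hasDerivAt_exp_mul_fun α x ((hd x (by linarith [hx.1])).sub_const (θ * b)))
    (fun x hx => by
      have h2 := (abs_le.1 (Iop_abs hμ hτ hψ x (fun r hr _ => hb r (by linarith [hx.1])))).1
      rw [← hθ] at h2
      exact mul_nonpos_of_nonneg_of_nonpos (Real.exp_pos _).le (by linarith))
  have h3 := (abs_le.1 (hb (T + τ) (by linarith))).2
  have h4 : Real.exp (α * (T + τ)) * (ψ (T + τ) - θ * b) ≤ Real.exp (α * (T + τ)) * b :=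
    mul_le_mul_of_nonneg_left (by have := mul_nonneg hθ0 hb0; linarith) (Real.exp_pos _).le
  have h5 := mul_le_mul_of_nonneg_left (h1.trans h4) (Real.exp_pos (-α * t)).le
  have e4 : Real.exp (-α * t) * Real.exp (α * t) = 1 := by
    rw [← Real.exp_add]; simp
  have e5 : Real.exp (-α * t) * Real.exp (α * (T + τ)) = Real.exp (-α * (t - (T + τ))) := by
    rw [← Real.exp_add]; congr 1; ring
  rw [← mul_assoc, ← mul_assoc, e4, e5] at h5
  linarith

lemma decay {α μ τ C : ℝ} {ψ : ℝ → ℝ} (hμ : 0 < μ) (hτ : 0 ≤ τ)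
    (hα : α * μ = 1 + Real.exp (-(μ * τ))) (hψ : Continuous ψ) (hC : ∀ t, |ψ t| ≤ C)
    (hd : ∀ t, τ < t → HasDerivAt ψ (-α * ψ t - Iop μ τ ψ t) t) : Tendsto ψ atTop (nhds 0) := by
  have hX := Real.exp_pos (-(μ * τ))
  have hX1 : Real.exp (-(μ * τ)) ≤ 1 := Real.exp_le_one_iff.2 (by have := mul_nonneg hμ.le hτ; linarith)
  have hα0 : 0 < α := by
    by_contra h
    push Not at h
    nlinarith
  set θ := (1 - Real.exp (-(μ * τ))) / μ / α with hθ
  have hβ0 : 0 ≤ (1 - Real.exp (-(μ * τ))) / μ := div_nonneg (by linarith) hμ.le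
  have hθ0 : 0 ≤ θ := div_nonneg hβ0 hα0.le
  have hθ1 : θ < 1 := by rw [hθ, div_lt_one hα0, div_lt_iff₀ hμ]; linarith
  have hθe : α * θ = (1 - Real.exp (-(μ * τ))) / μ := by rw [hθ]; field_simp
  have hC0 : 0 ≤ C := (abs_nonneg _).trans (hC 0)
  have hstep : ∀ b T, 0 ≤ b → 0 ≤ T → (∀ t, T ≤ t → |ψ t| ≤ b) →
      ∃ T', 0 ≤ T' ∧ ∀ t, T' ≤ t → |ψ t| ≤ (1 + θ) / 2 * b := by
    intro b T hb0 hT hb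
    have h1 := decay_half hμ hτ hα0 hψ hT hd hθ0 hθe hb0 hb
    have h2 := decay_half (ψ := fun t => - ψ t) hμ hτ hα0 hψ.neg hT
      (fun t ht => (hd t ht).neg.congr_deriv (by rw [Iop_neg]; ring)) hθ0 hθe hb0
      (fun t ht => by rw [abs_neg]; exact hb t ht)
    have h3 : Tendsto (fun t : ℝ => Real.exp (-α * (t - (T + τ)))) atTop (nhds 0) := by
      have : Tendsto (fun s : ℝ => α * (s - (T + τ))) atTop atTop :=
        (tendsto_atTop_add_const_right _ (-(T + τ)) tendsto_id).const_mul_atTop hα0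
      have := (Real.tendsto_exp_neg_atTop_nhds_zero.comp this)
      refine this.congr fun t => ?_
      simp only [Function.comp]; congr 1; ring
    obtain ⟨N, hN⟩ := eventually_atTop.1 (h3.eventually_lt_const (show 0 < (1 - θ) / 2 by linarith))
    refine ⟨max N (T + τ), le_max_of_le_right (by linarith), fun t ht => ?_⟩
    have h4 := hN t ((le_max_left _ _).trans ht)
    have h5 := h1 t ((le_max_right _ _).trans ht)
    have h6 := h2 t ((le_max_right _ _).trans ht)
    have h7 := mul_le_mul_of_nonneg_right h4.le hb0
    rw [abs_le]; constructor <;> nlinarith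
  have hall : ∀ n : ℕ, ∃ T, 0 ≤ T ∧ ∀ t, T ≤ t → |ψ t| ≤ ((1 + θ) / 2) ^ n * C := by
    intro n
    induction n with
    | zero => exact ⟨0, le_rfl, fun t _ => by simpa using hC t⟩
    | succ n ih =>
      obtain ⟨T, hT, h1⟩ := ih
      obtain ⟨T', hT', h2⟩ := hstep _ T (by positivity) hT h1
      refine ⟨T', hT', fun t ht => (h2 t ht).trans (le_of_eq (by ring))⟩
  rw [Metric.tendsto_atTop]
  intro ε hε
  have h1 : Tendsto (fun n : ℕ => ((1 + θ) / 2) ^ n * C) atTop (nhds 0) := by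
    have := (tendsto_pow_atTop_nhds_zero_of_lt_one (show 0 ≤ (1 + θ) / 2 by linarith)
      (show (1 + θ) / 2 < 1 by linarith)).mul_const C
    simpa using this
  obtain ⟨n, hn⟩ := (h1.eventually_lt_const hε).exists
  obtain ⟨T, _, hT⟩ := hall n
  exact ⟨T, fun t ht => by rw [Real.dist_eq, sub_zero]; exact (hT t ht).trans_lt hn⟩

lemma e_ident {k c τ l1 l2 : ℝ} {e : ℝ → ℝ}
    (He : ∀ T, LS k c τ T e (fun t => l1 * e t - Real.exp (l2 * t))) (t : ℝ) :
    k * e (t - τ) = (l1 + l2 - c) * Real.exp (l2 * t) - (l1 ^ 2 - c * l1 - 1) * e t := by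
  have H := He (t + 1)
  have h1 := H.heq t (by linarith)
  have h2 : HasDerivAt (fun t => l1 * e t - Real.exp (l2 * t))
      (l1 * (l1 * e t - Real.exp (l2 * t)) - l2 * Real.exp (l2 * t)) t :=
    ((H.hf t).const_mul l1).sub (hasDerivAt_exp_mul l2 t)
  have := h1.unique h2
  linear_combination -this

lemma hasDerivAt_glue {f1 f2 : ℝ → ℝ} {a τ : ℝ} (h1 : HasDerivAt f1 a τ) (h2 : HasDerivAt f2 a τ)
    (h : f1 τ = f2 τ) : HasDerivAt (fun t => if t ≤ τ then f1 t else f2 t) a τ := by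
  have e1 : HasDerivWithinAt (fun t => if t ≤ τ then f1 t else f2 t) a (Iic τ) τ := by
    refine h1.hasDerivWithinAt.congr (fun x hx => ?_) ?_
    · exact if_pos hx
    · exact if_pos le_rfl
  have e2 : HasDerivWithinAt (fun t => if t ≤ τ then f1 t else f2 t) a (Ici τ) τ := by
    refine h2.hasDerivWithinAt.congr (fun x hx => ?_) ?_
    · rcases (show τ ≤ x from hx).lt_or_eq with h3 | h3
      · exact if_neg (not_le.2 h3)
      · rw [← h3]; simpa using h
    · simpa using h
  have := e1.union e2
  rwa [Iic_union_Ici, hasDerivWithinAt_univ] at this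

lemma hasDerivAt_glue_lt {f1 f2 : ℝ → ℝ} {a τ t : ℝ} (h1 : HasDerivAt f1 a t) (ht : t < τ) :
    HasDerivAt (fun t => if t ≤ τ then f1 t else f2 t) a t := by
  refine h1.congr_of_eventuallyEq ?_
  filter_upwards [Iio_mem_nhds ht] with x hx
  exact if_pos (le_of_lt hx)

lemma hasDerivAt_glue_gt {f1 f2 : ℝ → ℝ} {a τ t : ℝ} (h1 : HasDerivAt f2 a t) (ht : τ < t) :
    HasDerivAt (fun t => if t ≤ τ then f1 t else f2 t) a t := by
  refine h1.congr_of_eventuallyEq ?_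
  filter_upwards [Ioi_mem_nhds ht] with x hx
  exact if_neg (not_le.2 hx)

/-- gluing a given left solution to a bounded right solution -/
lemma extend {k c τ μ : ℝ} {p pd : ℝ → ℝ} (hτ : 0 ≤ τ) (hμ : 0 < μ)
    (hchi : μ ^ 2 - c * μ - 1 - Real.exp (-(μ * τ)) = 0)
    (Hp : ∀ T, LS k c τ T p pd)
    {P : ℝ → ℝ} (hP : ∀ x, HasDerivAt P ((p x - 2) * Real.exp (-(μ * x))) x)
    (hJ : pd τ + (μ - c) * (p τ - 2) + (P τ - P 0) = 0) :
    ∃ f d : ℝ → ℝ, (∀ t, HasDerivAt f (d t) t) ∧ Continuous d ∧ (∀ t ≤ τ, f t = p t) ∧ (∀ t ≤ τ, d t = pd t) ∧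
      Tendsto f atTop (nhds 2) ∧ (∀ t < τ, HasDerivAt d (c * d t + f t - k * f (t - τ)) t) ∧
      (∀ t, τ < t → HasDerivAt d (c * d t + f t - (4 - f (t - τ))) t) := by
  have hpc := (Hp 0).fc
  have hpdc := (Hp 0).hdc
  have hpf := (Hp 0).hf
  obtain ⟨B0, hB0⟩ := isCompact_Icc.exists_bound_of_continuousOn (s := Icc 0 τ) (f := fun t => p t - 2)
    (by fun_prop)
  have hα : (μ - c) * μ = 1 + Real.exp (-(μ * τ)) := by linear_combination hchi
  obtain ⟨ψ, R, hψc, ⟨C, hC⟩, hψq, hψR, hRd⟩ := right_solve (α := μ - c) (B := B0)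
    (q := fun t => p (max 0 (min t τ)) - 2) hμ hτ hα (by fun_prop)
    (fun t => hB0 (max 0 (min t τ)) ⟨le_max_left _ _, max_le hτ (min_le_right _ _)⟩)
  have hψp : ∀ t, 0 ≤ t → t ≤ τ → ψ t = p t - 2 := by
    intro t h0 ht
    rw [hψq t ht, min_eq_left ht, max_eq_right h0]
  have hRc : Continuous R := continuous_iff_continuousAt.2 fun t => (hRd t).continuousAt
  have hIc := Iop_cont (μ := μ) (τ := τ) hψc
  have hRτ : R τ = p τ - 2 := by rw [← hψR τ le_rfl, hψp τ hτ le_rfl]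
  have hIτ : Iop μ τ ψ τ = P τ - P 0 := by
    unfold Iop
    rw [sub_self, mul_zero, Real.exp_zero, one_mul]
    have h1 : ∫ r in (0:ℝ)..τ, ψ r * Real.exp (-(μ * r)) = ∫ r in (0:ℝ)..τ, (p r - 2) * Real.exp (-(μ * r)) := by
      apply intervalIntegral.integral_congr
      intro r hr
      rw [uIcc_of_le hτ] at hr
      simp only
      rw [hψp r hr.1 hr.2]
    rw [h1]
    refine intervalIntegral.integral_eq_sub_of_hasDerivAt (fun x _ => hP x) ?_
    have : Continuous fun x => (p x - 2) * Real.exp (-(μ * x)) := by fun_prop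
    exact this.intervalIntegrable _ _
  have hmatch : pd τ = -(μ - c) * R τ - Iop μ τ ψ τ := by
    rw [hRτ, hIτ]; linarith
  set f : ℝ → ℝ := fun t => if t ≤ τ then p t else 2 + R t with hfdef
  set d : ℝ → ℝ := fun t => if t ≤ τ then pd t else -(μ - c) * R t - Iop μ τ ψ t with hddef
  have hfp : ∀ t ≤ τ, f t = p t := fun t ht => if_pos ht
  have hdp : ∀ t ≤ τ, d t = pd t := fun t ht => if_pos ht
  have hfR : ∀ t, τ < t → f t = 2 + R t := fun t ht => if_neg (not_le.2 ht)
  have hdR : ∀ t, τ < t → d t = -(μ - c) * R t - Iop μ τ ψ t := fun t ht => if_neg (not_le.2 ht)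
  have hψf : ∀ t, 0 ≤ t → ψ t = f t - 2 := by
    intro t ht
    rcases le_or_gt t τ with h | h
    · rw [hψp t ht h, hfp t h]
    · rw [hψR t h.le, hfR t h]; ring
  refine ⟨f, d, ?_, ?_, hfp, hdp, ?_, ?_, ?_⟩
  · intro t
    rcases lt_trichotomy t τ with h | h | h
    · rw [hdp t h.le]; exact hasDerivAt_glue_lt (hpf t) h
    · rw [h, hdp τ le_rfl]
      refine hasDerivAt_glue (hpf τ) ?_ (by rw [hRτ]; ring)
      rw [hmatch]; exact (hRd τ).const_add 2
    · rw [hdR t h]; exact hasDerivAt_glue_gt ((hRd t).const_add 2) h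
  · refine Continuous.if_le hpdc (by fun_prop) continuous_id continuous_const ?_
    rintro x hx
    have hx : x = τ := hx
    rw [hx]; exact hmatch
  · have h1 := decay hμ hτ hα hψc hC (fun t ht => by
      have : HasDerivAt ψ (-(μ - c) * R t - Iop μ τ ψ t) t := by
        refine (hRd t).congr_of_eventuallyEq ?_
        filter_upwards [Ioi_mem_nhds ht] with x hx
        exact hψR x (le_of_lt hx)
      rwa [← hψR t ht.le] at this)
    have h2 := h1.const_add 2
    rw [add_zero] at h2
    refine h2.congr' ?_
    filter_upwards [eventually_ge_atTop 0] with t ht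
    rw [hψf t ht]; ring
  · intro t ht
    rw [hdp t ht.le, hfp t ht.le, hfp (t - τ) (by linarith)]
    exact hasDerivAt_glue_lt ((Hp τ).heq t ht) ht
  · intro t ht
    have h1 : HasDerivAt (fun t => -(μ - c) * R t - Iop μ τ ψ t) (c * d t + f t - (4 - f (t - τ))) t := by
      refine (((hRd t).const_mul (-(μ - c))).sub (Iop_deriv hψc t)).congr_deriv ?_
      rw [hdR t ht, hfR t ht, hψf (t - τ) (by linarith), hψR t ht.le]
      linear_combination R t * hα
    exact hasDerivAt_glue_gt h1 ht

lemma exists_front {k c h μ l1 l2 : ℝ} (hk1 : 1 < k) (hk3 : k < 3) (hτ : 0 ≤ c * h)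
    (hl1 : l1 ^ 2 - c * l1 - 1 + k * Real.exp (-(l1 * (c * h))) = 0) (h20 : 0 < l2)
    (hl2 : (l2 < l1 ∧ l2 ^ 2 - c * l2 - 1 + k * Real.exp (-(l2 * (c * h))) = 0) ∨
      (l2 = l1 ∧ 2 * l1 - c - k * (c * h) * Real.exp (-(l1 * (c * h))) = 0))
    (hlμ : l1 < μ) (hchi : μ ^ 2 - c * μ - 1 - Real.exp (-(μ * (c * h))) = 0)
    (hq : (3 - k) / 4 * μ ≤ l1) : ∃ φ, ToyWavefront k c h φ := by
  obtain ⟨e, he0, hepos, hebot, He⟩ := exists_e hl1 h20 hl2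
  have hl21 : l2 ≤ l1 := by
    rcases hl2 with h | h
    · exact h.1.le
    · exact h.1.le
  have hl2r : l2 ^ 2 - c * l2 - 1 + k * Real.exp (-(l2 * (c * h))) = 0 := by
    rcases hl2 with h | h
    · exact h.2
    · rw [h.1]; exact hl1
  have hl10 : 0 < l1 := h20.trans_le hl21
  have hμ : 0 < μ := hl10.trans hlμ
  unfold ToyWavefront
  clear hl2
  generalize c * h = τ at *
  set V := (μ - l2) * (1 - 4 * (μ - l1) / (μ * (k + 1))) with hV
  have hden : 0 < μ * (k + 1) := by positivity
  have hy0 : 4 * (μ - l1) / (μ * (k + 1)) ≤ 1 := by rw [div_le_one hden]; linarith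
  have hV0 : 0 ≤ V := mul_nonneg (by linarith) (by linarith)
  have hVl : V < l1 := by
    have h1 : V ≤ μ * (1 - 4 * (μ - l1) / (μ * (k + 1))) :=
      mul_le_mul_of_nonneg_right (by linarith) (by linarith)
    have h2 : μ * (1 - 4 * (μ - l1) / (μ * (k + 1))) = μ - 4 * (μ - l1) / (k + 1) := by field_simp
    have h3 : μ - l1 < 4 * (μ - l1) / (k + 1) := by
      rw [lt_div_iff₀ (by linarith)]; nlinarith
    linarith
  have He1 : ∀ T, LS k c τ T (fun t => Real.exp (l1 * t)) (fun t => l1 * Real.exp (l1 * t)) := by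
    intro T
    refine ⟨fun t => hasDerivAt_exp_mul l1 t, by fun_prop, fun t _ => ?_⟩
    refine ((hasDerivAt_exp_mul l1 t).const_mul l1).congr_deriv ?_
    have e1 : Real.exp (l1 * (t - τ)) = Real.exp (l1 * t) * Real.exp (-(l1 * τ)) := by
      rw [← Real.exp_add]; congr 1; ring
    rw [e1]
    linear_combination Real.exp (l1 * t) * hl1
  obtain ⟨p, hp⟩ : ∃ p : ℝ → ℝ, p = fun t => 1 * Real.exp (l1 * t) + V * e t := ⟨_, rfl⟩
  obtain ⟨pd, hpd⟩ : ∃ pd : ℝ → ℝ, pd = fun t => 1 * (l1 * Real.exp (l1 * t)) + V * (l1 * e t - Real.exp (l2 * t)) :=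
    ⟨_, rfl⟩
  have Hp : ∀ T, LS k c τ T p pd := fun T => by rw [hp, hpd]; exact (He1 T).comb (He T) 1 V
  have hpdp : ∀ t, pd t = l1 * p t - V * Real.exp (l2 * t) := by
    intro t; rw [hp, hpd]; ring
  have hp0 : p 0 = 1 := by rw [hp]; simp [he0]
  have hpd0 : 0 < pd 0 := by rw [hpdp, hp0]; simp; linarith
  have hppos : ∀ t ≤ 0, 0 < p t := by
    intro t ht
    rw [hp]
    have := mul_nonneg hV0 (hepos t ht)
    have := Real.exp_pos (l1 * t)
    simp only
    linarith
  have hU : ∀ T a t, a < t → t ≤ T → pd a ≤ 0 → pd t < 0 := fun T =>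
    unimod (T := T) (Hp 0).hf hl10 h20 hV0 (fun h0 t _ => by
      rw [hp, h0]; have := Real.exp_pos (l1 * t); simp only; linarith) (fun t _ => hpdp t)
  have hpdpos : ∀ t ≤ 0, 0 < pd t := by
    intro t ht
    rcases ht.lt_or_eq with h1 | h1
    · by_contra h2
      push Not at h2
      linarith [hU 0 t 0 h1 le_rfl h2]
    · rw [h1]; exact hpd0
  have hplt : ∀ t < 0, p t < 1 := by
    intro t ht
    rw [← hp0]
    exact smono_of_deriv ht (Hp 0).fc.continuousOn (fun x _ => (Hp 0).hf x) (fun x hx => hpdpos x hx.2.le)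
  have hpbot : Tendsto p atBot (nhds 0) := by
    have h1 : Tendsto (fun t : ℝ => Real.exp (l1 * t)) atBot (nhds 0) :=
      Real.tendsto_exp_atBot.comp (tendsto_id.const_mul_atBot hl10)
    have := (h1.const_mul 1).add (hebot.const_mul V)
    rw [hp]; simpa using this
  -- the primitive
  have hA : μ - l1 ≠ 0 := by linarith
  have hB : μ - l2 ≠ 0 := by linarith
  obtain ⟨P, hPe⟩ : ∃ P : ℝ → ℝ, P = fun x => -(μ - l1)⁻¹ * Real.exp ((l1 - μ) * x)
      + V * (-(μ - l1)⁻¹ * (Real.exp (-μ * x) * e x - (μ - l2)⁻¹ * Real.exp ((l2 - μ) * x)))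
      + 2 * μ⁻¹ * Real.exp (-μ * x) := ⟨_, rfl⟩
  have eX : ∀ l x, Real.exp ((l - μ) * x) = Real.exp (l * x) * Real.exp (-(μ * x)) := by
    intro l x
    rw [← Real.exp_add]; congr 1; ring
  have eX2 : ∀ x, Real.exp (-μ * x) = Real.exp (-(μ * x)) := fun x => by congr 1; ring
  have hP : ∀ x, HasDerivAt P ((p x - 2) * Real.exp (-(μ * x))) x := by
    intro x
    rw [hPe, hp]
    refine ((((hasDerivAt_exp_mul (l1 - μ) x).const_mul (-(μ - l1)⁻¹)).add
      ((((hasDerivAt_exp_mul_fun (-μ) x ((He 0).hf x)).sub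
        ((hasDerivAt_exp_mul (l2 - μ) x).const_mul (μ - l2)⁻¹)).const_mul (-(μ - l1)⁻¹)).const_mul V)).add
      ((hasDerivAt_exp_mul (-μ) x).const_mul (2 * μ⁻¹))).congr_deriv ?_
    simp only [eX, eX2]
    field_simp
    ring
  have hJ : pd τ + (μ - c) * (p τ - 2) + (P τ - P 0) = 0 := by
    have hid := e_ident He τ
    rw [sub_self, he0, mul_zero] at hid
    rw [hpdp, hp, hPe]
    simp only [eX, eX2, mul_zero, Real.exp_zero, he0]
    have hE1 : Real.exp (l1 * τ) * Real.exp (-(l1 * τ)) = 1 := by rw [← Real.exp_add]; simp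
    have hE2 : Real.exp (l2 * τ) * Real.exp (-(l2 * τ)) = 1 := by rw [← Real.exp_add]; simp
    have hVe : V * (μ * (k + 1)) = (μ - l2) * (μ * (k + 1) - 4 * (μ - l1)) := by
      rw [hV]; field_simp
    generalize Real.exp (l1 * τ) = E1 at *
    generalize Real.exp (l2 * τ) = E2 at *
    generalize Real.exp (-(l1 * τ)) = F1 at *
    generalize Real.exp (-(l2 * τ)) = F2 at *
    generalize Real.exp (-(μ * τ)) = X at *
    generalize e τ = eτ at *
    clear_value V
    have h1 : (μ - l1) * (μ - l2) * μ ≠ 0 := mul_ne_zero (mul_ne_zero hA hB) hμ.ne'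
    have s1 : E1 * ((l1 + μ - c) * (μ - l1) - X) = k := by
      linear_combination -E1 * hl1 + E1 * hchi + k * hE1
    have s2 : E2 * ((l2 + μ - c) * (μ - l2) - X) = k := by
      linear_combination -E2 * hl2r + E2 * hchi + k * hE2
    have s3 : μ * (μ - c) = 1 + X := by linear_combination hchi
    have s4 : eτ * ((l1 + μ - c) * (μ - l1) - X) = - (l1 + l2 - c) * E2 := by
      linear_combination -hid + eτ * hchi
    have iA : (μ - l1) * (μ - l1)⁻¹ = 1 := mul_inv_cancel₀ hA
    have iB : (μ - l2) * (μ - l2)⁻¹ = 1 := mul_inv_cancel₀ hB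
    have iM : μ * μ⁻¹ = 1 := mul_inv_cancel₀ hμ.ne'
    generalize (μ - l1)⁻¹ = A at *
    generalize (μ - l2)⁻¹ = B at *
    generalize μ⁻¹ = M at *
    apply mul_left_cancel₀ h1
    have t1 : (μ - l1) * (E1 * (l1 + μ - c) + A * (1 - E1 * X)) = k + 1 := by
      linear_combination s1 + (1 - E1 * X) * iA
    have t2 : μ * (-2 * (μ - c) + 2 * M * (X - 1)) = -4 := by
      linear_combination -2 * s3 + 2 * (X - 1) * iM
    have t3 : (μ - l1) * (μ - l2) * (eτ * (l1 + μ - c) - E2 - A * (eτ * X - B * E2 * X + B)) = - (k + 1) := by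
      linear_combination (μ - l2) * s4 - (μ - l2) * (eτ * X - B * E2 * X + B) * iA + (E2 * X - 1) * iB - s2
    linear_combination (μ - l2) * μ * t1 + (μ - l1) * (μ - l2) * t2 + V * μ * t3 - hVe
  obtain ⟨f, d, hf, hdc, hfp, hdp, h2, H1, H2⟩ := extend hτ hμ hchi Hp hP hJ
  have hfc : Continuous f := continuous_iff_continuousAt.2 fun t => (hf t).continuousAt
  have hf0 : f 0 = 1 := by rw [hfp 0 hτ, hp0]
  have hflt : ∀ t < 0, f t < 1 := fun t ht => by rw [hfp t (by linarith)]; exact hplt t ht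
  have hgt := no_return (k := k) (c := c) hf hdc hτ hk1 hk3 hf0
    (fun t ht => by
      rcases ht.lt_or_eq with h1 | h1
      · exact (hflt t h1).le
      · rw [h1, hf0])
    (fun a t hat ht hd => by
      rw [hdp a (by linarith)] at hd
      rw [hdp t ht]; exact hU τ a t hat ht hd)
    h2 (Or.inl (by rw [hdp 0 hτ]; exact hpd0)) H1 (fun t ht _ => H2 t ht)
    (fun t ht h3 => ⟨_, H2 t ht, fun h4 => by linarith⟩)
  have hder : deriv f = d := funext fun t => (hf t).deriv
  refine ⟨f, ?_, ?_, ?_, h2, ?_⟩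
  · rw [contDiff_one_iff_deriv]
    exact ⟨fun t => (hf t).differentiableAt, by rw [hder]; exact hdc⟩
  · intro t
    rcases le_or_gt t 0 with h | h
    · rw [hfp t (by linarith)]; exact hppos t h
    · linarith [hgt t h]
  · refine hpbot.congr' ?_
    filter_upwards [eventually_le_atBot τ] with t ht
    exact (hfp t ht).symm
  · intro t ht
    rw [hder]
    rcases lt_trichotomy t τ with h | h | h
    · rw [gtoy, if_pos (hflt _ (by linarith))]; exact H1 t h
    · rw [h, sub_self] at ht; exact absurd hf0 ht
    · have := hgt (t - τ) (by linarith)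
      rw [gtoy, if_neg (not_lt.2 this.le)]; exact H2 t h

lemma no_front_lt {k c cs h zs : ℝ} {φ : ℝ → ℝ} (hk : 1 < k) (hh : 0 ≤ h) (hcs : c < cs)
    (h0 : chi k cs h zs = 0)
    (h1 : 2 * zs - cs - k * cs * h * Real.exp (-(zs * cs * h)) = 0)
    (H : ToyWavefront k c h φ) : False := by
  obtain ⟨f, d, hf, hdc, hpos, hbot, -, f0, hlt, heq⟩ := front_normalize H
  rcases le_or_gt c 0 with hc | hc
  · refine no_front_nonpos hk hc hh hf hpos hbot (fun t ht => ?_)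
    have := heq t ht.ne
    rwa [gtoy, if_pos ht] at this
  · obtain ⟨Y, -, hY⟩ := log_deriv_bound (k := k) (c := c) (T := c * h) (by linarith) (mul_nonneg hc.le hh) hf hdc
      (fun t _ => hpos t) hbot (fun t ht => by
        have h2 := hlt (t - c * h) (by linarith)
        have := heq t h2.ne
        rwa [gtoy, if_pos h2] at this)
    have := chi_pos_of_lt_sharp hk hh hc hcs h0 h1 Y
    unfold chi at this
    rw [mul_assoc Y c h] at this
    linarith

lemma front_ge {k c cs h zs l m : ℝ} {φ : ℝ → ℝ} (hk1 : 1 < k) (hk3 : k < 3) (hh : 0 ≤ h)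
    (hcs : 0 < cs) (hc : cs ≤ c) (hz : 0 < zs) (h0 : chi k cs h zs = 0)
    (h1 : 2 * zs - cs - k * cs * h * Real.exp (-(zs * cs * h)) = 0)
    (hlp : 0 < l) (hl0 : chi k c h l = 0) (hl : ∀ z : ℝ, chi k c h z = 0 → z ≤ l)
    (hm : 0 < m) (hm0 : chiK c h m = 0) (hmu : ∀ z : ℝ, 0 < z → chiK c h z = 0 → z = m)
    (H : ToyWavefront k c h φ) : (3 - k) / 4 * m ≤ l := by
  obtain ⟨f, d, hf, hdc, hpos, hbot, h2, f0, hlt, heq⟩ := front_normalize H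
  have hcp : 0 < c := hcs.trans_le hc
  have hτ : 0 ≤ c * h := mul_nonneg hcp.le hh
  have hLS : ∀ t < c * h, HasDerivAt d (c * d t + f t - k * f (t - c * h)) t := fun t ht => by
    have h2 := hlt (t - c * h) (by linarith)
    have := heq t h2.ne
    rwa [gtoy, if_pos h2] at this
  obtain ⟨Y, hdY, hY⟩ := log_deriv_bound (k := k) (c := c) (T := c * h) (by linarith) hτ hf hdc
      (fun t _ => hpos t) hbot hLS
  have hYl : Y ≤ l := by
    by_contra hn
    have := chi_pos_of_gt hk1 hl (not_le.1 hn)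
    unfold chi at this
    rw [mul_assoc Y c h] at this
    linarith
  have hdl : ∀ t ≤ c * h, d t ≤ l * f t := fun t ht =>
    (hdY t ht).trans (mul_le_mul_of_nonneg_right hYl (hpos t).le)
  obtain ⟨l2, h20, hl2⟩ := exists_lam2 hk1 hcs hc hz h0 h1 hl0 hl
  have hlm : l < m := mu_gt hcp hh hmu hlp (chiK_lam hk1 hl0)
  have hmc := mu_gt_c hm hm0
  unfold chi at hl0 hl2
  unfold chiK at hm0
  rw [mul_assoc _ c h] at hl0 hm0
  rw [mul_assoc l2 c h, mul_assoc l c h, mul_assoc k c h] at hl2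
  obtain ⟨e, he0, hepos, hebot, He⟩ := exists_e hl0 h20 hl2
  have hκ : 0 ≤ l + l2 - c := by
    have := e_ident He 0
    rw [he0] at this
    simp at this
    have h5 := mul_nonneg (by linarith : (0:ℝ) ≤ k) (hepos (-(c * h)) (by linarith))
    linarith
  obtain ⟨V, hV, hVd⟩ := LS.rigid (⟨hf, hdc, hLS⟩ : LS k c (c * h) (c * h) f d) (by linarith) hτ hl0 (He _) hκ hdl
  have U := unimod hf hlp h20 hV (fun _ t _ => hpos t) hVd
  have hgt := cross hf hdc hτ hk1 hk3 f0 hlt hpos U h2 hm hmc hm0 heq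
  exact front_ratio hf hdc hτ f0 hgt h2 hlp hlm hmc hm0 hl0 hdl heq

lemma front_of_ge {k c cs h zs l m : ℝ} (hk1 : 1 < k) (hk3 : k < 3) (hh : 0 ≤ h)
    (hcs : 0 < cs) (hc : cs ≤ c) (hz : 0 < zs) (h0 : chi k cs h zs = 0)
    (h1 : 2 * zs - cs - k * cs * h * Real.exp (-(zs * cs * h)) = 0)
    (hlp : 0 < l) (hl0 : chi k c h l = 0) (hl : ∀ z : ℝ, chi k c h z = 0 → z ≤ l)
    (hm0 : chiK c h m = 0) (hmu : ∀ z : ℝ, 0 < z → chiK c h z = 0 → z = m)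
    (hq : (3 - k) / 4 * m ≤ l) : ∃ φ, ToyWavefront k c h φ := by
  have hcp : 0 < c := hcs.trans_le hc
  have hτ : 0 ≤ c * h := mul_nonneg hcp.le hh
  obtain ⟨l2, h20, hl2⟩ := exists_lam2 hk1 hcs hc hz h0 h1 hl0 hl
  have hlm : l < m := mu_gt hcp hh hmu hlp (chiK_lam hk1 hl0)
  unfold chi at hl0 hl2
  unfold chiK at hm0
  rw [mul_assoc _ c h] at hl0 hm0
  rw [mul_assoc l2 c h, mul_assoc l c h, mul_assoc k c h] at hl2
  exact exists_front hk1 hk3 hτ hl0 h20 hl2 hlm hm0 hq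

/-- If the determining equation `λ₁(c)/μ₁(c) = (3-k)/4` has a solution `c_* ≥ c_#(h)`,
then `c_*` is the minimal speed of propagation: a wavefront of speed `c` exists iff
`c ≥ c_*`. If the determining equation has no positive root, then `c_#(h)` is the minimal
speed of propagation. -/
theorem toy_minimal_speed
    (k h : ℝ) (hk1 : 1 < k) (hk3 : k < 3) (hh : 0 ≤ h)
    (csharp : ℝ) (hcsharp_pos : 0 < csharp)
    (hcsharp : ∃ z : ℝ, 0 < z ∧ chi k csharp h z = 0 ∧
      2 * z - csharp - k * csharp * h * Real.exp (-(z * csharp * h)) = 0)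
    (hcsharp_uniq : ∀ c : ℝ, 0 < c →
      (∃ z : ℝ, 0 < z ∧ chi k c h z = 0 ∧
        2 * z - c - k * c * h * Real.exp (-(z * c * h)) = 0) → c = csharp)
    (lam1 mu1 : ℝ → ℝ)
    (hlam1 : ∀ c : ℝ, csharp ≤ c →
      0 < lam1 c ∧ chi k c h (lam1 c) = 0 ∧ ∀ z : ℝ, chi k c h z = 0 → z ≤ lam1 c)
    (hmu1 : ∀ c : ℝ, 0 < c →
      0 < mu1 c ∧ chiK c h (mu1 c) = 0 ∧ ∀ z : ℝ, 0 < z → chiK c h z = 0 → z = mu1 c) :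
    (∀ cstar : ℝ, csharp ≤ cstar → lam1 cstar / mu1 cstar = (3 - k) / 4 →
      ∀ c : ℝ, (∃ φ : ℝ → ℝ, ToyWavefront k c h φ) ↔ cstar ≤ c) ∧
    ((¬ ∃ c : ℝ, 0 < c ∧ csharp ≤ c ∧ lam1 c / mu1 c = (3 - k) / 4) →
      ∀ c : ℝ, (∃ φ : ℝ → ℝ, ToyWavefront k c h φ) ↔ csharp ≤ c) := by
  obtain ⟨zs, hz, h0, h1⟩ := hcsharp
  have hq : 0 < (3 - k) / 4 := by linarith
  have hq1 : (3 - k) / 4 < 1 := by linarith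
  refine ⟨fun cst hcst heq c => ?_, fun hno c => ?_⟩
  · have hcstp := hcsharp_pos.trans_le hcst
    obtain ⟨a1, a2, a3⟩ := hlam1 cst hcst
    obtain ⟨b1, b2, b3⟩ := hmu1 cst hcstp
    have heq' : lam1 cst = (3 - k) / 4 * mu1 cst := by rwa [div_eq_iff b1.ne'] at heq
    constructor
    · rintro ⟨φ, H⟩
      by_contra hlt
      push Not at hlt
      rcases lt_or_ge c csharp with hc | hc
      · exact no_front_lt hk1 hh hc h0 h1 H
      · obtain ⟨p1, p2, p3⟩ := hlam1 c hc
        obtain ⟨r1, r2, r3⟩ := hmu1 c (hcsharp_pos.trans_le hc)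
        obtain ⟨s1, s2, s3⟩ := hmu1 csharp hcsharp_pos
        have e1 := front_ge hk1 hk3 hh hcsharp_pos hc hz h0 h1 p1 p2 p3 r1 r2 r3 H
        have e2 := ratio_lt hk1 hh hq hq1 hcsharp_pos hz h0 hc hlt p2 r1 r2 r3 a3 b2 b1 b3 s1 s2 s3 heq' a2
        linarith
    · intro hc
      have hcc := hcst.trans hc
      obtain ⟨p1, p2, p3⟩ := hlam1 c hcc
      obtain ⟨r1, r2, r3⟩ := hmu1 c (hcsharp_pos.trans_le hcc)
      exact front_of_ge hk1 hk3 hh hcsharp_pos hcc hz h0 h1 p1 p2 p3 r2 r3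
        (ratio_ge hk1 hh hq hq1 hcstp hc p3 r2 r3 b2 b1 (heq' ▸ a2))
  · constructor
    · rintro ⟨φ, H⟩
      by_contra hlt
      push Not at hlt
      exact no_front_lt hk1 hh hlt h0 h1 H
    · intro hcc
      obtain ⟨p1, p2, p3⟩ := hlam1 c hcc
      obtain ⟨r1, r2, r3⟩ := hmu1 c (hcsharp_pos.trans_le hcc)
      exact front_of_ge hk1 hk3 hh hcsharp_pos hcc hz h0 h1 p1 p2 p3 r2 r3
        (ratio_nosol hk1 hh hq hq1 hcsharp_pos hz h0 hlam1 hmu1 hno hcc)
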